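/- arXiv:math/0301077 — 4 statements merged into one kernel-verified Lean document; each statement's English description precedes it below -/
import Mathlib

section
/- Let u : [0,π] → ℂ be a function of bounded variation, and for n ≥ 1 set r_n := (2/π)·∫₀^π u(t)·cos(2nt)·(∫₀ᵗ u(s)·sin(2ns) ds) dt + (1/(2πn))·∫₀^π u(t)² dt. Then there exists M > 0 such that |r_n| ≤ M/n² for all n ≥ 1. -/
open MeasureTheory Set

/-- `r_n = (2/π)∫₀^π u(t)cos(2nt)(∫₀ᵗ u(s)sin(2ns) ds) dt + (1/(2πn))∫₀^π u² dt`. -/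
noncomputable def rseq (u : ℝ → ℂ) (n : ℕ) : ℂ :=
  (2 / (Real.pi : ℂ)) * (∫ t in (0:ℝ)..Real.pi, u t * Complex.cos (2 * (n:ℂ) * t) *
      (∫ s in (0:ℝ)..t, u s * Complex.sin (2 * (n:ℂ) * s)))
  + (1 / (2 * (Real.pi : ℂ) * n)) * ∫ t in (0:ℝ)..Real.pi, (u t) ^ 2

lemma aux_real_int (f : ℝ → ℝ) (hf : BoundedVariationOn f (Icc 0 Real.pi)) :
    IntervalIntegrable f volume 0 Real.pi := by
  obtain ⟨p, q, hp, hq, rfl⟩ :=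
    hf.locallyBoundedVariationOn.exists_monotoneOn_sub_monotoneOn
  rw [← uIcc_of_le Real.pi_pos.le] at hp hq
  exact hp.intervalIntegrable.sub hq.intervalIntegrable

lemma aux_int (u : ℝ → ℂ) (hu : BoundedVariationOn u (Icc 0 Real.pi)) :
    IntervalIntegrable u volume 0 Real.pi := by
  have h1 := aux_real_int (fun t => (u t).re)
    ((Complex.reCLM.lipschitz.lipschitzOnWith (s := univ)).comp_boundedVariationOn
      (mapsTo_univ _ _) hu)
  have h2 := aux_real_int (fun t => (u t).im)
    ((Complex.imCLM.lipschitz.lipschitzOnWith (s := univ)).comp_boundedVariationOn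
      (mapsTo_univ _ _) hu)
  have h3 : IntervalIntegrable (fun t => ((u t).re : ℂ) + ((u t).im : ℂ) * Complex.I)
      volume 0 Real.pi := by
    refine IntervalIntegrable.add ?_ (IntervalIntegrable.mul_const ?_ _)
    · exact ⟨h1.1.ofReal, h1.2.ofReal⟩
    · exact ⟨h2.1.ofReal, h2.2.ofReal⟩
  simpa [Complex.re_add_im] using h3

lemma hasDeriv_sin (N : ℂ) (t : ℝ) :
    HasDerivAt (fun s : ℝ => Complex.sin (N * s)) (N * Complex.cos (N * t)) t := by
  have h0 : HasDerivAt (fun z : ℂ => N * z) N (t : ℂ) := by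
    simpa using (hasDerivAt_id (t : ℂ)).const_mul N
  refine h0.csin.comp_ofReal.congr_deriv ?_
  ring

lemma hasDeriv_cos (N : ℂ) (t : ℝ) :
    HasDerivAt (fun s : ℝ => Complex.cos (N * s)) (-(N * Complex.sin (N * t))) t := by
  have h0 : HasDerivAt (fun z : ℂ => N * z) N (t : ℂ) := by
    simpa using (hasDerivAt_id (t : ℂ)).const_mul N
  refine h0.ccos.comp_ofReal.congr_deriv ?_
  ring

lemma int_sin (N : ℂ) (hN : N ≠ 0) (a t : ℝ) (ha : Complex.cos (N * a) = 1) (c : ℂ) :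
    ∫ s in a..t, c * Complex.sin (N * s) = c * ((1 - Complex.cos (N * t)) / N) := by
  have := intervalIntegral.integral_eq_sub_of_hasDerivAt (a := a) (b := t)
    (f := fun s : ℝ => -(c / N) * Complex.cos (N * s))
    (f' := fun s : ℝ => c * Complex.sin (N * s))
    (fun s _ => by
      refine ((hasDeriv_cos N s).const_mul (-(c / N))).congr_deriv ?_
      field_simp)
    (Continuous.intervalIntegrable (by fun_prop) _ _)
  rw [this, ha]
  field_simp
  ring

lemma int_main (N : ℂ) (hN : N ≠ 0) (a b : ℝ) (ha : Complex.sin (N * a) = 0)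
    (hb : Complex.sin (N * b) = 0) (c K : ℂ) :
    ∫ t in a..b, (c * Complex.cos (N * t) * (K + c * ((1 - Complex.cos (N * t)) / N))
      + 1 / (2 * N) * c ^ 2) = 0 := by
  have := intervalIntegral.integral_eq_sub_of_hasDerivAt (a := a) (b := b)
    (f := fun s : ℝ => (c * K / N + c ^ 2 / N ^ 2) * Complex.sin (N * s)
      - c ^ 2 / (2 * N ^ 2) * (Complex.sin (N * s) * Complex.cos (N * s)))
    (f' := fun t : ℝ => (c * Complex.cos (N * t) * (K + c * ((1 - Complex.cos (N * t)) / N))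
      + 1 / (2 * N) * c ^ 2))
    (fun s _ => by
      refine (((hasDeriv_sin N s).const_mul (c * K / N + c ^ 2 / N ^ 2)).sub
        (((hasDeriv_sin N s).mul (hasDeriv_cos N s)).const_mul
          (c ^ 2 / (2 * N ^ 2)))).congr_deriv ?_
      have h : Complex.sin (N * s) ^ 2 = 1 - Complex.cos (N * s) ^ 2 := by
        rw [← Complex.sin_sq_add_cos_sq (N * s)]; ring
      field_simp
      ring_nf
      rw [h]
      ring)
    (Continuous.intervalIntegrable (by fun_prop) _ _)
  rw [this, ha, hb]
  ring

lemma norm_trig (x : ℝ) : ‖Complex.cos (x : ℂ)‖ ≤ 1 ∧ ‖Complex.sin (x : ℂ)‖ ≤ 1 := by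
  rw [← Complex.ofReal_cos, ← Complex.ofReal_sin, Complex.norm_real, Complex.norm_real]
  exact ⟨Real.abs_cos_le_one x, Real.abs_sin_le_one x⟩

/-- oscillating integral against `u` close to a constant -/
lemma local_sin (u : ℝ → ℂ) (n : ℕ) (hn : 1 ≤ n) (a t : ℝ) (hat : a ≤ t) (c : ℂ) (W : ℝ)
    (ha : Complex.cos (2 * (n : ℂ) * a) = 1)
    (hi : IntervalIntegrable u volume a t) (hW : ∀ s ∈ Icc a t, ‖u s - c‖ ≤ W) :
    ‖(∫ s in a..t, u s * Complex.sin (2 * (n : ℂ) * s))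
      - c * ((1 - Complex.cos (2 * (n : ℂ) * t)) / (2 * (n : ℂ)))‖ ≤ W * (t - a) := by
  have hN : (2 * (n : ℂ)) ≠ 0 := by
    have : (n : ℂ) ≠ 0 := by exact_mod_cast (by omega : n ≠ 0)
    simpa using this
  have hW0 : 0 ≤ W := (norm_nonneg _).trans (hW a ⟨le_rfl, hat⟩)
  rw [← int_sin _ hN a t ha c, ← intervalIntegral.integral_sub
    (hi.mul_continuousOn (by fun_prop)) (Continuous.intervalIntegrable (by fun_prop) _ _)]
  have := intervalIntegral.norm_integral_le_of_norm_le_const (a := a) (b := t) (C := W)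
    (f := fun s => u s * Complex.sin (2 * (n : ℂ) * s) - c * Complex.sin (2 * (n : ℂ) * s))
    (fun s hs => by
      rw [uIoc_of_le hat] at hs
      rw [← sub_mul, norm_mul]
      have h1 := hW s ⟨hs.1.le, hs.2⟩
      have h2 := (norm_trig (2 * n * s)).2
      push_cast at h2
      nlinarith [norm_nonneg (Complex.sin (2 * (n : ℂ) * s)), norm_nonneg (u s - c)])
  rwa [abs_of_nonneg (by linarith)] at this

lemma local_main (u : ℝ → ℂ) (n : ℕ) (hn : 1 ≤ n) (a b h : ℝ) (hab : b = a + h)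
    (hh : 1 / (n : ℝ) ≤ h) (W B V : ℝ) (F : ℝ → ℂ)
    (ha : Complex.cos (2 * (n : ℂ) * a) = 1)
    (ha' : Complex.sin (2 * (n : ℂ) * a) = 0) (hb' : Complex.sin (2 * (n : ℂ) * b) = 0)
    (hi : IntervalIntegrable u volume a b)
    (hB : ∀ s ∈ Icc a b, ‖u s‖ ≤ B)
    (hW : ∀ s ∈ Icc a b, ‖u s - u a‖ ≤ W)
    (hF : ∀ t ∈ Icc a b, F t = F a + ∫ s in a..t, u s * Complex.sin (2 * (n : ℂ) * s))
    (hFa : ‖F a‖ ≤ V * h)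
    (hfi : IntervalIntegrable (fun t => u t * Complex.cos (2 * (n : ℂ) * t) * F t
      + 1 / (2 * (2 * (n : ℂ))) * u t ^ 2) volume a b) :
    ‖∫ t in a..b, (u t * Complex.cos (2 * (n : ℂ) * t) * F t
      + 1 / (2 * (2 * (n : ℂ))) * u t ^ 2)‖ ≤ W * ((V + 4 * B) * h ^ 2) := by
  have hn0 : (0 : ℝ) < n := by exact_mod_cast hn
  have hN : (2 * (n : ℂ)) ≠ 0 := by
    have : (n : ℂ) ≠ 0 := by exact_mod_cast (by omega : n ≠ 0)
    simpa using this
  have hinv : 0 < 1 / (n : ℝ) := by positivity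
  have hh0 : 0 < h := by linarith
  have hle : a ≤ b := by linarith
  have hW0 : 0 ≤ W := (norm_nonneg _).trans (hW a ⟨le_rfl, hle⟩)
  have hB0 : 0 ≤ B := (norm_nonneg _).trans (hB a ⟨le_rfl, hle⟩)
  have hca := hB a ⟨le_rfl, hle⟩
  set c := u a with hc
  have key : ∫ t in a..b, (u t * Complex.cos (2 * (n : ℂ) * t) * F t
      + 1 / (2 * (2 * (n : ℂ))) * u t ^ 2) =
      ∫ t in a..b, ((u t * Complex.cos (2 * (n : ℂ) * t) * F t
      + 1 / (2 * (2 * (n : ℂ))) * u t ^ 2) -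
      (c * Complex.cos (2 * (n : ℂ) * t) *
        (F a + c * ((1 - Complex.cos (2 * (n : ℂ) * t)) / (2 * (n : ℂ))))
      + 1 / (2 * (2 * (n : ℂ))) * c ^ 2)) := by
    rw [intervalIntegral.integral_sub hfi (Continuous.intervalIntegrable (by fun_prop) _ _),
      int_main _ hN a b ha' hb', sub_zero]
  rw [key]
  have := intervalIntegral.norm_integral_le_of_norm_le_const (a := a) (b := b)
    (C := W * ((V + 4 * B) * h))
    (f := fun t => ((u t * Complex.cos (2 * (n : ℂ) * t) * F t
      + 1 / (2 * (2 * (n : ℂ))) * u t ^ 2) -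
      (c * Complex.cos (2 * (n : ℂ) * t) *
        (F a + c * ((1 - Complex.cos (2 * (n : ℂ) * t)) / (2 * (n : ℂ))))
      + 1 / (2 * (2 * (n : ℂ))) * c ^ 2)))
    (fun t ht => by
      rw [uIoc_of_le hle] at ht
      have ht' : t ∈ Icc a b := ⟨ht.1.le, ht.2⟩
      have hsub : Icc a t ⊆ Icc a b := Icc_subset_Icc_right ht.2
      have hE := local_sin u n hn a t ht.1.le c W ha
        (hi.mono_set (by rw [uIcc_of_le ht.1.le, uIcc_of_le hle]; exact hsub))
        (fun s hs => hW s (hsub hs))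
      have hcos := (norm_trig (2 * n * t)).1
      push_cast at hcos
      rw [hF t ht']
      have h1 := hW t ht'
      have h2 := hB t ht'
      set E := ∫ s in a..t, u s * Complex.sin (2 * (n : ℂ) * s)
      set C := Complex.cos (2 * (n : ℂ) * t)
      set E0 := c * ((1 - C) / (2 * (n : ℂ))) with hE0
      have hE' : ‖E - E0‖ ≤ W * h :=
        hE.trans (mul_le_mul_of_nonneg_left (by linarith [ht.2]) hW0)
      have hE0n : ‖E0‖ ≤ B * h := by
        rw [hE0, norm_mul]
        refine mul_le_mul hca ?_ (norm_nonneg _) hB0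
        rw [norm_div, norm_mul, Complex.norm_natCast, Complex.norm_ofNat]
        have : ‖1 - C‖ ≤ 2 := by
          have := norm_sub_le (1 : ℂ) C
          rw [norm_one] at this
          linarith
        calc ‖1 - C‖ / (2 * (n : ℝ)) ≤ 2 / (2 * (n : ℝ)) := by gcongr
          _ = 1 / (n : ℝ) := by field_simp
          _ ≤ h := hh
      have e : (u t * C * (F a + E) + 1 / (2 * (2 * (n : ℂ))) * u t ^ 2) -
          (c * C * (F a + E0) + 1 / (2 * (2 * (n : ℂ))) * c ^ 2)
          = (u t - c) * C * F a + u t * C * (E - E0) + (u t - c) * C * E0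
            + 1 / (2 * (2 * (n : ℂ))) * ((u t - c) * (u t + c)) := by ring
      rw [e]
      have hq : ‖(1 / (2 * (2 * (n : ℂ))) : ℂ)‖ ≤ h := by
        rw [norm_div, norm_mul, norm_mul, Complex.norm_natCast, Complex.norm_ofNat, norm_one]
        refine le_trans ?_ hh
        apply one_div_le_one_div_of_le hn0
        linarith
      have b1 : ‖(u t - c) * C * F a‖ ≤ W * 1 * (V * h) := by
        rw [norm_mul, norm_mul]; gcongr
      have b2 : ‖u t * C * (E - E0)‖ ≤ B * 1 * (W * h) := by
        rw [norm_mul, norm_mul]; gcongr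
      have b3 : ‖(u t - c) * C * E0‖ ≤ W * 1 * (B * h) := by
        rw [norm_mul, norm_mul]; gcongr
      have b4 : ‖1 / (2 * (2 * (n : ℂ))) * ((u t - c) * (u t + c))‖ ≤ h * (W * (B + B)) := by
        rw [norm_mul, norm_mul]
        have := (norm_add_le (u t) c).trans (add_le_add h2 hca)
        gcongr
      refine (norm_add_le _ _).trans ?_
      refine (add_le_add ((norm_add_le _ _).trans (add_le_add (norm_add_le _ _) le_rfl))
        le_rfl).trans ?_
      nlinarith)
  refine this.trans (le_of_eq ?_)
  rw [hab, add_sub_cancel_left, abs_of_pos hh0]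
  ring

theorem rn_estimate_bounded_variation
    (u : ℝ → ℂ) (hu : BoundedVariationOn u (Icc 0 Real.pi)) :
    ∃ M > (0:ℝ), ∀ n : ℕ, 1 ≤ n → ‖rseq u n‖ ≤ M / (n:ℝ) ^ 2 := by
  have hpi := Real.pi_pos
  set V := (eVariationOn u (Icc 0 Real.pi)).toReal with hV
  have hV0 : 0 ≤ V := ENNReal.toReal_nonneg
  set B := ‖u 0‖ + V with hBdef
  have hB0 : 0 ≤ B := by positivity
  have hB : ∀ s ∈ Icc 0 Real.pi, ‖u s‖ ≤ B := by
    intro s hs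
    have h1 := hu.dist_le hs (⟨le_rfl, hpi.le⟩ : (0 : ℝ) ∈ Icc 0 Real.pi)
    rw [dist_eq_norm] at h1
    have h2 := norm_add_le (u 0) (u s - u 0)
    rw [add_sub_cancel] at h2
    linarith
  have hui := aux_int u hu
  have hu2 : IntervalIntegrable (fun t => u t ^ 2) volume 0 Real.pi := by
    rw [intervalIntegrable_iff] at hui ⊢
    have := Integrable.bdd_mul (c := B) hui hui.aestronglyMeasurable (by
      rw [ae_restrict_iff' measurableSet_uIoc]
      refine Filter.Eventually.of_forall fun s hs => hB s ?_
      rw [uIoc_of_le hpi.le] at hs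
      exact ⟨hs.1.le, hs.2⟩)
    simpa [IntegrableOn, sq] using this
  refine ⟨2 * Real.pi * (V * (V + 4 * B)) + 1, by positivity, fun n hn => ?_⟩
  have hn0 : (0 : ℝ) < n := by exact_mod_cast hn
  have hnC : (n : ℂ) ≠ 0 := by exact_mod_cast hn0.ne'
  set h := Real.pi / n with hh
  have hh0 : 0 < h := by positivity
  have hh1 : 1 / (n : ℝ) ≤ h := by
    rw [hh]; gcongr; linarith [Real.two_le_pi]
  set a : ℕ → ℝ := fun k => k * h with haD
  have ha0 : a 0 = 0 := by simp [haD]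
  have han : a n = Real.pi := by simp only [haD, hh]; field_simp
  have hamono : Monotone a := by
    intro i j hij
    simp only [haD]
    gcongr
  have hasucc : ∀ k, a (k + 1) = a k + h := by
    intro k; simp only [haD]; push_cast; ring
  have harg : ∀ k, 2 * (n : ℂ) * (a k : ℂ) = (k : ℂ) * (2 * Real.pi) := by
    intro k
    simp only [haD, hh]
    push_cast
    field_simp
  have hcos : ∀ k, Complex.cos (2 * (n : ℂ) * (a k : ℂ)) = 1 := by
    intro k; rw [harg]; exact Complex.cos_nat_mul_two_pi k
  have hsin : ∀ k, Complex.sin (2 * (n : ℂ) * (a k : ℂ)) = 0 := by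
    intro k; rw [harg]
    have := Complex.sin_nat_mul_pi (2 * k)
    rw [← this]; push_cast; ring_nf
  have hmem : ∀ k, k ≤ n → a k ∈ Icc 0 Real.pi := by
    intro k hk
    exact ⟨ha0 ▸ hamono (Nat.zero_le k), han ▸ hamono hk⟩
  have hsub : ∀ k, k < n → Icc (a k) (a (k + 1)) ⊆ Icc 0 Real.pi := fun k hk =>
    Icc_subset_Icc (hmem k hk.le).1 (hmem (k + 1) hk).2
  set W : ℕ → ℝ := fun k => (eVariationOn u (Icc (a k) (a (k + 1)))).toReal with hWD
  have hbv : ∀ k, k < n → BoundedVariationOn u (Icc (a k) (a (k + 1))) := fun k hk =>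
    hu.mono (hsub k hk)
  have hWsum : ∑ k ∈ Finset.range n, W k = V := by
    rw [hV, ← ENNReal.toReal_sum (fun k hk => hbv k (Finset.mem_range.1 hk)),
      eVariationOn.sum' u hamono, ha0, han]
  have hW0 : ∀ k, 0 ≤ W k := fun k => ENNReal.toReal_nonneg
  have hW : ∀ k, k < n → ∀ s ∈ Icc (a k) (a (k + 1)), ‖u s - u (a k)‖ ≤ W k := by
    intro k hk s hs
    rw [← dist_eq_norm]
    exact (hbv k hk).dist_le hs ⟨le_rfl, hamono (Nat.le_succ k)⟩
  have hsubu : ∀ x ∈ Icc 0 Real.pi, ∀ y ∈ Icc 0 Real.pi, uIcc x y ⊆ uIcc 0 Real.pi := by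
    intro x hx y hy
    rw [← uIcc_of_le hpi.le] at hx hy
    exact uIcc_subset_uIcc hx hy
  have husin : IntervalIntegrable (fun s => u s * Complex.sin (2 * (n : ℂ) * s)) volume
      0 Real.pi := hui.mul_continuousOn (by fun_prop)
  set F : ℝ → ℂ := fun t => ∫ s in (0:ℝ)..t, u s * Complex.sin (2 * (n : ℂ) * s) with hFD
  have h0mem : (0 : ℝ) ∈ Icc 0 Real.pi := ⟨le_rfl, hpi.le⟩
  have hFadd : ∀ x ∈ Icc 0 Real.pi, ∀ y ∈ Icc 0 Real.pi,
      F y = F x + ∫ s in x..y, u s * Complex.sin (2 * (n : ℂ) * s) := by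
    intro x hx y hy
    exact (intervalIntegral.integral_add_adjacent_intervals
      (husin.mono_set (hsubu 0 h0mem x hx)) (husin.mono_set (hsubu x hx y hy))).symm
  have hFc : ContinuousOn F (uIcc 0 Real.pi) :=
    intervalIntegral.continuousOn_primitive_interval' husin left_mem_uIcc
  have hFk : ∀ k, k ≤ n → ‖F (a k)‖ ≤ (∑ i ∈ Finset.range k, W i) * h := by
    intro k
    induction k with
    | zero => intro _; simp [hFD, ha0]
    | succ k ih =>
      intro hk
      rw [hFadd _ (hmem k (by omega)) _ (hmem (k + 1) hk), Finset.sum_range_succ, add_mul]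
      refine (norm_add_le _ _).trans (add_le_add (ih (by omega)) ?_)
      have := local_sin u n hn (a k) (a (k + 1)) (hamono (Nat.le_succ k)) (u (a k)) (W k)
        (hcos k) (hui.mono_set (hsubu _ (hmem k (by omega)) _ (hmem (k + 1) hk))) (hW k hk)
      rw [hcos (k + 1), sub_self, zero_div, mul_zero, sub_zero, hasucc k,
        add_sub_cancel_left] at this
      rw [hasucc k]
      exact this
  have hFV : ∀ k, k ≤ n → ‖F (a k)‖ ≤ V * h := by
    intro k hk
    refine (hFk k hk).trans (mul_le_mul_of_nonneg_right ?_ hh0.le)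
    rw [← hWsum]
    exact Finset.sum_le_sum_of_subset_of_nonneg (Finset.range_mono hk) (fun i _ _ => hW0 i)
  have hf1 : IntervalIntegrable (fun t => u t * Complex.cos (2 * (n : ℂ) * t) * F t)
      volume 0 Real.pi :=
    (hui.mul_continuousOn (by fun_prop)).mul_continuousOn hFc
  have hf2 : IntervalIntegrable (fun t => 1 / (2 * (2 * (n : ℂ))) * u t ^ 2)
      volume 0 Real.pi := hu2.const_mul _
  have hf := hf1.add hf2
  have hfk : ∀ k, k < n → IntervalIntegrable (fun t => u t * Complex.cos (2 * (n : ℂ) * t) * F t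
      + 1 / (2 * (2 * (n : ℂ))) * u t ^ 2) volume (a k) (a (k + 1)) := fun k hk =>
    hf.mono_set (hsubu _ (hmem k hk.le) _ (hmem (k + 1) hk))
  have htot : ‖∫ t in (0:ℝ)..Real.pi, (u t * Complex.cos (2 * (n : ℂ) * t) * F t
      + 1 / (2 * (2 * (n : ℂ))) * u t ^ 2)‖ ≤ V * ((V + 4 * B) * h ^ 2) := by
    have := intervalIntegral.sum_integral_adjacent_intervals (a := a) (n := n) hfk
    rw [ha0, han] at this
    rw [← this, ← hWsum, Finset.sum_mul]
    refine (norm_sum_le _ _).trans (Finset.sum_le_sum fun k hk => ?_)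
    rw [Finset.mem_range] at hk
    rw [hWsum]
    exact local_main u n hn (a k) (a (k + 1)) h (hasucc k) hh1 (W k) B V F (hcos k) (hsin k)
      (hsin (k + 1)) (hui.mono_set (hsubu _ (hmem k hk.le) _ (hmem (k + 1) hk)))
      (fun s hs => hB s (hsub k hk hs)) (hW k hk)
      (fun t ht => hFadd _ (hmem k hk.le) _ (hsub k hk ht)) (hFV k hk.le) (hfk k hk)
  have hr : rseq u n = (2 / (Real.pi : ℂ)) *
      ∫ t in (0:ℝ)..Real.pi, (u t * Complex.cos (2 * (n : ℂ) * t) * F t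
      + 1 / (2 * (2 * (n : ℂ))) * u t ^ 2) := by
    rw [intervalIntegral.integral_add hf1 hf2, intervalIntegral.integral_const_mul, rseq, mul_add]
    congr 1
    have : (Real.pi : ℂ) ≠ 0 := by exact_mod_cast hpi.ne'
    field_simp
    try ring
  rw [hr, norm_mul, norm_div, Complex.norm_ofNat, Complex.norm_real, Real.norm_of_nonneg hpi.le]
  calc 2 / Real.pi * _ ≤ 2 / Real.pi * (V * ((V + 4 * B) * h ^ 2)) := by gcongr
    _ = (2 * Real.pi * (V * (V + 4 * B))) / (n : ℝ) ^ 2 := by rw [hh]; field_simp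
    _ ≤ _ := by gcongr; linarith
end

section
/- Let 0 < θ < 1/2 and let (a_k)_{k≥1} be a sequence of complex numbers with ∑_{k≥1} k^{2θ}·|a_k|² < ∞. For n ≥ 1 set ξ_n := ∑_{k≥1, k≠2n} a_k²·( 1/(2n+k) + 1/(2n−k) − 1/n ) (an absolutely convergent series). Then ∑_{n=1}^∞ n^{2θ}·|ξ_n| / log(n+1) < ∞, and for every p > 1: ∑_{n=1}^∞ ( n^{2θ}·|ξ_n| )^p < ∞. -/
open Set

/-- Term of the series `ξ_n = ∑_{k≥1, k≠2n} a_k² (1/(2n+k) + 1/(2n−k) − 1/n)`. -/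
noncomputable def xiTerm (a : ℕ → ℂ) (n k : ℕ) : ℂ :=
  if k = 0 ∨ k = 2 * n then 0
  else (a k) ^ 2 * (1 / (2 * (n:ℂ) + k) + 1 / (2 * (n:ℂ) - k) - 1 / (n:ℂ))

/-- `ξ_n = ∑_{k≥1, k≠2n} a_k² (1/(2n+k) + 1/(2n−k) − 1/n)`. -/
noncomputable def xiSeq (a : ℕ → ℂ) (n : ℕ) : ℂ := ∑' k : ℕ, xiTerm a n k

/-- The weighted kernel. -/
noncomputable def xiK (s : ℝ) (n k : ℕ) : ℝ :=
  (n:ℝ) ^ s * (k:ℝ) ^ (-s) * ((k:ℝ) ^ 2 / (n * |4 * (n:ℝ) ^ 2 - (k:ℝ) ^ 2|))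

lemma xiK_nonneg (s : ℝ) (n k : ℕ) : 0 ≤ xiK s n k := by
  unfold xiK; positivity

lemma xiK_zero (s : ℝ) (n : ℕ) : xiK s n 0 = 0 := by
  simp [xiK]

lemma xiTerm_eq (s : ℝ) (a : ℕ → ℂ) (n k : ℕ) (hn : 1 ≤ n) :
    (n:ℝ) ^ s * ‖xiTerm a n k‖ = ((k:ℝ) ^ s * ‖a k‖ ^ 2) * xiK s n k := by
  unfold xiTerm
  split_ifs with h
  · rcases h with rfl | rfl
    · simp [xiK_zero]
    · have : 4 * (n:ℝ) ^ 2 - ((2 * n : ℕ):ℝ) ^ 2 = 0 := by push_cast; ring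
      rw [xiK, this]; simp
  · push Not at h
    have hk : 0 < (k:ℝ) := by exact_mod_cast Nat.pos_of_ne_zero h.1
    have hn' : (0:ℝ) < n := by exact_mod_cast hn
    have hnc : (n:ℂ) ≠ 0 := by exact_mod_cast hn'.ne'
    have h1 : (2 * (n:ℂ) + k) ≠ 0 := by
      have : 2 * n + k ≠ 0 := by omega
      exact_mod_cast this
    have h2 : (2 * (n:ℂ) - k) ≠ 0 := by
      rw [sub_ne_zero]
      exact_mod_cast h.2.symm
    have key : (1 / (2 * (n:ℂ) + k) + 1 / (2 * (n:ℂ) - k) - 1 / (n:ℂ))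
        = (((k:ℝ) ^ 2 / (n * (4 * (n:ℝ) ^ 2 - (k:ℝ) ^ 2)) : ℝ) : ℂ) := by
      push_cast
      have : (4 * (n:ℂ) ^ 2 - (k:ℂ) ^ 2) = (2 * (n:ℂ) + k) * (2 * (n:ℂ) - k) := by ring
      rw [this]
      field_simp
      ring
    rw [key, norm_mul, norm_pow, Complex.norm_real, Real.norm_eq_abs, abs_div, abs_mul,
      abs_of_nonneg (by positivity : (0:ℝ) ≤ (k:ℝ)^2), abs_of_pos hn']
    unfold xiK
    have : (k:ℝ) ^ s * (k:ℝ) ^ (-s) = 1 := by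
      rw [← Real.rpow_add hk]; simp
    linear_combination (-(n:ℝ) ^ s * ‖a k‖ ^ 2 * ((k:ℝ) ^ 2 / (n * |4 * (n:ℝ) ^ 2 - (k:ℝ) ^ 2|))) * this

lemma xiK_near (s : ℝ) (hs0 : 0 < s) (hs1 : s < 1) (n k : ℕ) (hn : 1 ≤ n) (hk : 1 ≤ k)
    (h : k ≤ 4 * n) :
    xiK s n k ≤ 4 * (k / ((2 * n + k) * |2 * (n:ℝ) - k|)) := by
  have hn' : (0:ℝ) < n := by exact_mod_cast hn
  have hk' : (0:ℝ) < k := by exact_mod_cast hk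
  have h' : (k:ℝ) ≤ 4 * n := by exact_mod_cast h
  have e : xiK s n k = (((n:ℝ) / k) ^ s * (k / n)) * (k / ((2 * n + k) * |2 * (n:ℝ) - k|)) := by
    unfold xiK
    have : 4 * (n:ℝ) ^ 2 - (k:ℝ) ^ 2 = (2 * n + k) * (2 * (n:ℝ) - k) := by ring
    rw [this, abs_mul, abs_of_pos (by positivity : (0:ℝ) < 2 * n + k),
      Real.div_rpow hn'.le hk'.le, Real.rpow_neg hk'.le]
    by_cases h0 : |2 * (n:ℝ) - k| = 0
    · rw [h0]; simp
    · field_simp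
  rw [e]
  refine mul_le_mul_of_nonneg_right ?_ (by positivity)
  have : ((n:ℝ) / k) ^ s ≤ 4 * (n / k) := by
    rcases le_total 1 ((n:ℝ) / k) with h1 | h1
    · calc ((n:ℝ) / k) ^ s ≤ ((n:ℝ) / k) ^ (1:ℝ) := Real.rpow_le_rpow_of_exponent_le h1 hs1.le
        _ = n / k := Real.rpow_one _
        _ ≤ _ := by linarith
    · calc ((n:ℝ) / k) ^ s ≤ 1 := Real.rpow_le_one (by positivity) h1 hs0.le
        _ ≤ 4 * (n / k) := by
          rw [← mul_div_assoc, le_div_iff₀ hk']; linarith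
  calc ((n:ℝ) / k) ^ s * (k / n) ≤ 4 * (n / k) * (k / n) := by gcongr
    _ = 4 := by field_simp

lemma xiK_far (s : ℝ) (n k : ℕ) (hn : 1 ≤ n) (h : 4 * n < k) :
    xiK s n k ≤ 2 * ((n:ℝ) ^ (s - 1) * (k:ℝ) ^ (-s)) := by
  have hn' : (0:ℝ) < n := by exact_mod_cast hn
  have h' : 4 * (n:ℝ) < k := by exact_mod_cast h
  have hk' : (0:ℝ) < k := by linarith
  unfold xiK
  have h2 : 0 < (k:ℝ) ^ 2 - 4 * (n:ℝ) ^ 2 := by nlinarith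
  rw [abs_sub_comm, abs_of_pos h2, Real.rpow_sub_one hn'.ne']
  have : (k:ℝ) ^ 2 / (n * ((k:ℝ) ^ 2 - 4 * (n:ℝ) ^ 2)) ≤ 2 / n := by
    rw [div_le_div_iff₀ (by positivity) hn']
    nlinarith [mul_pos hn' h2, mul_pos hn' hn', mul_pos hn' (by nlinarith : 0 < (k:ℝ) ^ 2 - 8 * (n:ℝ) ^ 2)]
  calc _ ≤ (n:ℝ) ^ s * (k:ℝ) ^ (-s) * (2 / n) := by gcongr
    _ = _ := by ring

lemma xiK_simple (s : ℝ) (hs0 : 0 < s) (hs1 : s < 1) (n k : ℕ) (hn : 1 ≤ n) :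
    xiK s n k ≤ 2 / n ∨ xiK s n k ≤ 4 / |2 * (n:ℝ) - k| := by
  have hn' : (0:ℝ) < n := by exact_mod_cast hn
  rcases Nat.eq_zero_or_pos k with rfl | hk
  · left; rw [xiK_zero]; positivity
  have hk' : (0:ℝ) < k := by exact_mod_cast hk
  rcases le_or_gt k (4 * n) with h | h
  · right
    refine (xiK_near s hs0 hs1 n k hn hk h).trans ?_
    rw [div_mul_eq_div_div, div_eq_mul_one_div, div_eq_mul_one_div (4:ℝ)]
    have : (k:ℝ) / (2 * n + k) ≤ 1 := by
      rw [div_le_one (by positivity)]; linarith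
    have h0 : 0 ≤ 1 / |2 * (n:ℝ) - k| := by positivity
    nlinarith
  · left
    refine (xiK_far s n k hn h).trans ?_
    have h' : (n:ℝ) ≤ k := by exact_mod_cast (by omega : n ≤ k)
    have : (k:ℝ) ^ (-s) ≤ (n:ℝ) ^ (-s) :=
      Real.rpow_le_rpow_of_nonpos hn' h' (by linarith)
    calc _ ≤ 2 * ((n:ℝ) ^ (s - 1) * (n:ℝ) ^ (-s)) := by gcongr
      _ = 2 / n := by
        rw [← Real.rpow_add hn', show s - 1 + -s = -1 by ring, Real.rpow_neg_one]; rfl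

lemma xiK_sum_p (s : ℝ) (hs0 : 0 < s) (hs1 : s < 1) (p : ℝ) (hp : 1 < p) :
    ∃ C : ℝ, ∀ (S : Finset ℕ), (∀ n ∈ S, 1 ≤ n) → ∀ k : ℕ, ∑ n ∈ S, xiK s n k ^ p ≤ C := by
  have hZ := Real.summable_abs_int_rpow hp
  refine ⟨(2:ℝ) ^ p * (∑' m : ℤ, |(m:ℝ)| ^ (-p)) + 4 ^ p * (∑' m : ℤ, |(m:ℝ)| ^ (-p)), ?_⟩
  intro S hS k
  have inj (f : ℕ → ℤ) (hf : Function.Injective f) :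
      ∑ n ∈ S, |((f n : ℤ):ℝ)| ^ (-p) ≤ ∑' m : ℤ, |(m:ℝ)| ^ (-p) := by
    have := hZ.sum_le_tsum (S.map ⟨f, hf⟩) (fun i _ => by positivity)
    rwa [Finset.sum_map] at this
  have i1 := inj (fun n => (n:ℤ)) (fun x y h => by simpa using h)
  have i2 := inj (fun n => 2 * (n:ℤ) - k) (fun x y h => by
    simp only at h; omega)
  calc ∑ n ∈ S, xiK s n k ^ p ≤ ∑ n ∈ S, (2 ^ p * |(((n:ℤ)):ℝ)| ^ (-p)
        + 4 ^ p * |((2 * (n:ℤ) - k : ℤ):ℝ)| ^ (-p)) := by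
        refine Finset.sum_le_sum fun n hn => ?_
        have h0 := xiK_nonneg s n k
        have e (c x : ℝ) (hc : 0 ≤ c) : (c / |x|) ^ p = c ^ p * |x| ^ (-p) := by
          rw [Real.div_rpow hc (abs_nonneg _), Real.rpow_neg (abs_nonneg _)]; rfl
        push_cast
        rcases xiK_simple s hs0 hs1 n k (hS n hn) with h | h
        · have := Real.rpow_le_rpow h0 h (by linarith : 0 ≤ p)
          rw [← abs_of_nonneg (Nat.cast_nonneg n : (0:ℝ) ≤ n), e 2 _ (by norm_num)] at this
          rw [abs_of_nonneg (Nat.cast_nonneg n : (0:ℝ) ≤ n)] at this ⊢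
          have : 0 ≤ (4:ℝ) ^ p * |2 * (n:ℝ) - k| ^ (-p) := by positivity
          linarith
        · have := Real.rpow_le_rpow h0 h (by linarith : 0 ≤ p)
          rw [e 4 _ (by norm_num)] at this
          have : 0 ≤ (2:ℝ) ^ p * |(n:ℝ)| ^ (-p) := by positivity
          linarith
    _ ≤ _ := by
        rw [Finset.sum_add_distrib, ← Finset.mul_sum, ← Finset.mul_sum]
        gcongr

lemma sum_rpow_le (s : ℝ) (hs0 : 0 < s) (hs1 : s < 1) (N : ℕ) :
    ∑ n ∈ Finset.range N, ((n + 1 : ℕ):ℝ) ^ (s - 1) ≤ (N:ℝ) ^ s / s := by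
  induction N with
  | zero => simp [Real.zero_rpow hs0.ne']
  | succ N ih =>
    rw [Finset.sum_range_succ]
    set x : ℝ := ((N + 1 : ℕ):ℝ) with hx
    have hx0 : 0 < x := by positivity
    have hx1 : 1 ≤ x := by rw [hx]; push_cast; linarith [(Nat.cast_nonneg N : (0:ℝ) ≤ N)]
    have hN : (N:ℝ) = x * (1 + -(1/x)) := by
      rw [hx]; push_cast; field_simp; ring
    have hle : 1 / x ≤ 1 := by rw [div_le_one hx0]; exact hx1
    have b := rpow_one_add_le_one_add_mul_self (s := -(1/x)) (by linarith) hs0.le hs1.le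
    have : (N:ℝ) ^ s ≤ x ^ s - s * x ^ (s - 1) := by
      rw [hN, Real.mul_rpow hx0.le (by linarith), Real.rpow_sub_one hx0.ne']
      calc _ ≤ x ^ s * (1 + s * -(1/x)) := by gcongr
        _ = _ := by ring
    calc _ ≤ (N:ℝ) ^ s / s + x ^ (s - 1) := by linarith
      _ ≤ (x ^ s - s * x ^ (s - 1)) / s + x ^ (s - 1) := by gcongr
      _ = x ^ s / s := by field_simp; ring

lemma sum_harm (T : Finset ℕ) (k : ℕ) (f : ℕ → ℕ) (hf : ∀ n ∈ T, f n ≤ k)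
    (hinj : ∀ x ∈ T, ∀ y ∈ T, f x ≠ 0 → f x = f y → x = y) :
    ∑ n ∈ T, ((f n : ℕ):ℝ)⁻¹ ≤ 1 + Real.log k := by
  refine le_trans ?_ (harmonic_le_one_add_log k)
  rw [harmonic_eq_sum_Icc]
  push_cast
  rw [← Finset.sum_filter_of_ne (p := fun n => f n ≠ 0)]
  · rw [← Finset.sum_image (f := fun m : ℕ => (m:ℝ)⁻¹) (g := f)]
    · refine Finset.sum_le_sum_of_subset_of_nonneg ?_ (fun _ _ _ => by positivity)
      intro m hm
      simp only [Finset.mem_image, Finset.mem_filter, Finset.mem_Icc] at hm ⊢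
      obtain ⟨x, ⟨hx, h0⟩, rfl⟩ := hm
      exact ⟨by omega, hf x hx⟩
    · intro x hx y hy h
      simp only [Finset.coe_filter, Set.mem_ofPred_eq] at hx hy
      exact hinj x hx.1 y hy.1 hx.2 h
  · intro n _ h h0
    apply h; simp [h0]

lemma log_bound (n k : ℕ) (hn : 1 ≤ n) (hk : 1 ≤ k) (h : k ≤ 4 * n) :
    1 + Real.log k ≤ 5 * Real.log ((n:ℝ) + 1) := by
  have hn' : (1:ℝ) ≤ n := by exact_mod_cast hn
  have hk' : (0:ℝ) < k := by exact_mod_cast hk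
  have h' : (k:ℝ) ≤ 4 * n := by exact_mod_cast h
  have h1 : Real.log k ≤ Real.log (4 * n) := Real.log_le_log hk' h'
  have h2 : Real.log (4 * (n:ℝ)) = 2 * Real.log 2 + Real.log n := by
    rw [Real.log_mul (by norm_num) (by positivity), show (4:ℝ) = 2 ^ 2 by norm_num, Real.log_pow]
    norm_num
  have h3 : Real.log n ≤ Real.log ((n:ℝ) + 1) := Real.log_le_log (by positivity) (by linarith)
  have h4 : Real.log 2 ≤ Real.log ((n:ℝ) + 1) := Real.log_le_log (by norm_num) (by linarith)
  have := Real.log_two_gt_d9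
  linarith

lemma xiK_log_point (s : ℝ) (hs0 : 0 < s) (hs1 : s < 1) (n k : ℕ) (hn : 1 ≤ n) (hk : 1 ≤ k) :
    xiK s n k / Real.log ((n:ℝ) + 1) ≤
      (if n ≤ k then 4 * ((n:ℝ) ^ (s - 1) * (k:ℝ) ^ (-s)) else 0)
      + (if n ≤ k then 20 / (1 + Real.log k) * ((((k - 2 * n : ℕ)):ℝ)⁻¹ + (((2 * n - k : ℕ)):ℝ)⁻¹)
          else 0)
      + (if k < n then 4 * (k * ((n:ℝ) ^ 2)⁻¹) else 0) := by
  have hn' : (1:ℝ) ≤ n := by exact_mod_cast hn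
  have hk' : (1:ℝ) ≤ k := by exact_mod_cast hk
  have hlk : 0 ≤ Real.log k := Real.log_nonneg hk'
  have hL2 : 1 / 2 ≤ Real.log ((n:ℝ) + 1) := by
    have h4 : Real.log 2 ≤ Real.log ((n:ℝ) + 1) := Real.log_le_log (by norm_num) (by linarith)
    have := Real.log_two_gt_d9
    linarith
  have hL : 0 < Real.log ((n:ℝ) + 1) := by linarith
  have hK := xiK_nonneg s n k
  have t1 : 0 ≤ (if n ≤ k then 4 * ((n:ℝ) ^ (s - 1) * (k:ℝ) ^ (-s)) else 0) := by
    split_ifs <;> positivity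
  have t2 : 0 ≤ (if n ≤ k then 20 / (1 + Real.log k) * ((((k - 2 * n : ℕ)):ℝ)⁻¹ + (((2 * n - k : ℕ)):ℝ)⁻¹)
          else 0) := by
    split_ifs <;> positivity
  have t3 : 0 ≤ (if k < n then 4 * (k * ((n:ℝ) ^ 2)⁻¹) else 0) := by
    split_ifs <;> positivity
  have hdiv : xiK s n k / Real.log ((n:ℝ) + 1) ≤ 2 * xiK s n k := by
    rw [div_le_iff₀ hL]; nlinarith
  rcases lt_or_ge (4 * n) k with h | h
  · have := xiK_far s n k hn h
    rw [if_pos (by omega : n ≤ k)] at t1 ⊢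
    linarith
  have near := xiK_near s hs0 hs1 n k hn hk h
  rcases lt_or_ge k n with h2 | h2
  · have h2' : (k:ℝ) ≤ n := by exact_mod_cast h2.le
    have : (k:ℝ) / ((2 * n + k) * |2 * (n:ℝ) - k|) ≤ k * ((n:ℝ) ^ 2)⁻¹ / 2 := by
      rw [abs_of_nonneg (by linarith), div_eq_mul_inv, mul_div_assoc]
      refine mul_le_mul_of_nonneg_left ?_ (by positivity)
      rw [div_eq_mul_inv, ← mul_inv]
      apply inv_anti₀ (by positivity)
      nlinarith
    have : 2 * xiK s n k ≤ 4 * (k * ((n:ℝ) ^ 2)⁻¹) := by linarith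
    rw [if_pos h2] at t3 ⊢
    linarith
  · have e : |2 * (n:ℝ) - k|⁻¹ = (((k - 2 * n : ℕ)):ℝ)⁻¹ + (((2 * n - k : ℕ)):ℝ)⁻¹ := by
      rcases le_total k (2 * n) with h3 | h3
      · have h3' : (k:ℝ) ≤ 2 * n := by exact_mod_cast h3
        rw [Nat.sub_eq_zero_of_le h3, Nat.cast_sub h3, abs_of_nonneg (by linarith)]
        push_cast; simp
      · have h3' : 2 * (n:ℝ) ≤ k := by exact_mod_cast h3
        rw [Nat.sub_eq_zero_of_le h3, Nat.cast_sub h3, abs_sub_comm, abs_of_nonneg (by linarith)]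
        push_cast; simp
    have : (k:ℝ) / ((2 * n + k) * |2 * (n:ℝ) - k|) ≤ |2 * (n:ℝ) - k|⁻¹ := by
      rw [div_mul_eq_div_div, div_eq_mul_inv]
      have : (k:ℝ) / (2 * n + k) ≤ 1 := by
        rw [div_le_one (by positivity)]; linarith
      exact mul_le_of_le_one_left (by positivity) this
    have lb := log_bound n k hn hk h
    have : xiK s n k / Real.log ((n:ℝ) + 1) ≤ 20 / (1 + Real.log k) * |2 * (n:ℝ) - k|⁻¹ := by
      have hi : 0 ≤ |2 * (n:ℝ) - k|⁻¹ := by positivity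
      calc _ ≤ (4 * |2 * (n:ℝ) - k|⁻¹) / Real.log ((n:ℝ) + 1) := by gcongr; linarith
        _ ≤ (4 * |2 * (n:ℝ) - k|⁻¹) / ((1 + Real.log k) / 5) := by
          gcongr; linarith
        _ = _ := by field_simp; norm_num
    rw [e] at this
    rw [if_pos h2] at t1 ⊢
    rw [if_pos h2]
    linarith

lemma xiK_sum_log (s : ℝ) (hs0 : 0 < s) (hs1 : s < 1) :
    ∃ C : ℝ, ∀ (S : Finset ℕ), (∀ n ∈ S, 1 ≤ n) → ∀ k : ℕ,
      ∑ n ∈ S, xiK s n k / Real.log ((n:ℝ) + 1) ≤ C := by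
  refine ⟨4 / s + 40 + 8, ?_⟩
  intro S hS k
  rcases Nat.eq_zero_or_pos k with rfl | hk
  · simp only [xiK_zero, zero_div, Finset.sum_const_zero]; positivity
  have hk' : (1:ℝ) ≤ k := by exact_mod_cast hk
  have hlk : 0 ≤ Real.log k := Real.log_nonneg hk'
  refine (Finset.sum_le_sum fun n hn => xiK_log_point s hs0 hs1 n k (hS n hn) hk).trans ?_
  rw [Finset.sum_add_distrib, Finset.sum_add_distrib]
  refine add_le_add (add_le_add ?_ ?_) ?_
  · rw [← Finset.sum_filter, ← Finset.mul_sum, ← Finset.sum_mul]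
    have h1 : ∑ n ∈ S.filter (fun n => n ≤ k), (n:ℝ) ^ (s - 1) ≤ (k:ℝ) ^ s / s := by
      refine le_trans ?_ (sum_rpow_le s hs0 hs1 k)
      rw [← Finset.sum_image (f := fun m : ℕ => (m:ℝ) ^ (s - 1)) (g := fun n => n + 1)
        (fun x _ y _ h => by simpa using h)]
      refine Finset.sum_le_sum_of_subset_of_nonneg ?_ (fun _ _ _ => by positivity)
      intro n hn
      simp only [Finset.mem_image, Finset.mem_filter, Finset.mem_range] at hn ⊢
      have := hS n hn.1
      exact ⟨n - 1, by omega, by omega⟩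
    calc _ ≤ 4 * ((k:ℝ) ^ s / s * (k:ℝ) ^ (-s)) := by gcongr
      _ = 4 / s := by
        rw [Real.rpow_neg (by positivity)]
        have : (k:ℝ) ^ s ≠ 0 := by positivity
        field_simp
  · rw [← Finset.sum_filter, ← Finset.mul_sum, Finset.sum_add_distrib]
    have h1 := sum_harm (S.filter (fun n => n ≤ k)) k (fun n => k - 2 * n) (fun n _ => by omega)
      (fun x _ y _ h0 h => by omega)
    have h2 := sum_harm (S.filter (fun n => n ≤ k)) k (fun n => 2 * n - k)
      (fun n hn => by simp only [Finset.mem_filter] at hn; omega)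
      (fun x _ y _ h0 h => by omega)
    calc _ ≤ 20 / (1 + Real.log k) * ((1 + Real.log k) + (1 + Real.log k)) := by gcongr
      _ = 40 := by
        have : 1 + Real.log k ≠ 0 := by positivity
        field_simp; norm_num
  · rw [← Finset.sum_filter, ← Finset.mul_sum, ← Finset.mul_sum]
    have : ∑ n ∈ S.filter (fun n => k < n), ((n:ℝ) ^ 2)⁻¹ ≤ 2 / (k + 1) := by
      refine le_trans ?_ (sum_Ioo_inv_sq_le k (S.sup id + 1))
      refine Finset.sum_le_sum_of_subset_of_nonneg ?_ (fun _ _ _ => by positivity)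
      intro n hn
      simp only [Finset.mem_filter, Finset.mem_Ioo] at hn ⊢
      have := Finset.le_sup (f := id) hn.1
      simp only [id] at this
      exact ⟨hn.2, by omega⟩
    calc _ ≤ 4 * (k * (2 / ((k:ℝ) + 1))) := by gcongr
      _ ≤ 4 * 2 := by
        gcongr
        rw [← mul_div_assoc, div_le_iff₀ (by positivity)]; linarith
      _ = 8 := by norm_num

lemma schur_one (b : ℕ → ℝ) (hb0 : ∀ k, 0 ≤ b k) (hb : Summable b) (K : ℕ → ℕ → ℝ)
    (hK : ∀ n k, 0 ≤ K n k) (C : ℝ) (hC : ∀ N k, ∑ n ∈ Finset.range N, K n k ≤ C) :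
    (∀ n, Summable fun k => b k * K n k) ∧ Summable (fun n => ∑' k, b k * K n k) := by
  have hle : ∀ n k, K n k ≤ C := fun n k =>
    (Finset.single_le_sum (f := fun n => K n k) (fun i _ => hK i k)
      (Finset.self_mem_range_succ n)).trans (hC (n + 1) k)
  have hs : ∀ n, Summable fun k => b k * K n k := fun n =>
    Summable.of_nonneg_of_le (fun k => mul_nonneg (hb0 k) (hK n k))
      (fun k => mul_le_mul_of_nonneg_left (hle n k) (hb0 k)) (hb.mul_right C)
  refine ⟨hs, ?_⟩
  refine summable_of_sum_range_le (c := ∑' k, b k * C)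
    (fun n => tsum_nonneg fun k => mul_nonneg (hb0 k) (hK n k)) fun N => ?_
  rw [← Summable.tsum_finsetSum (fun i _ => hs i)]
  refine Summable.tsum_le_tsum (fun k => ?_) (summable_sum fun i _ => hs i) (hb.mul_right C)
  rw [← Finset.mul_sum]
  exact mul_le_mul_of_nonneg_left (hC N k) (hb0 k)

lemma schur_p (b : ℕ → ℝ) (hb0 : ∀ k, 0 ≤ b k) (hb : Summable b) (K : ℕ → ℕ → ℝ)
    (hK : ∀ n k, 0 ≤ K n k) (p : ℝ) (hp : 1 < p)
    (C : ℝ) (hC : ∀ N k, ∑ n ∈ Finset.range N, K n k ^ p ≤ C) :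
    Summable (fun n => (∑' k, b k * K n k) ^ p) := by
  obtain ⟨h1, h2⟩ := schur_one b hb0 hb (fun n k => K n k ^ p)
    (fun n k => Real.rpow_nonneg (hK n k) p) C hC
  have hp0 : 0 < p := by linarith
  have hpi : p⁻¹ < 1 := inv_lt_one_of_one_lt₀ hp
  refine Summable.of_nonneg_of_le
    (fun n => Real.rpow_nonneg (tsum_nonneg fun k => mul_nonneg (hb0 k) (hK n k)) p) (fun n => ?_)
    (h2.mul_left (((∑' k, b k) ^ (1 - p⁻¹)) ^ p))
  have hB : 0 ≤ ∑' k, b k := tsum_nonneg hb0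
  have hD : 0 ≤ ∑' k, b k * K n k ^ p :=
    tsum_nonneg fun k => mul_nonneg (hb0 k) (Real.rpow_nonneg (hK n k) p)
  have : ∑' k, b k * K n k ≤ (∑' k, b k) ^ (1 - p⁻¹) * (∑' k, b k * K n k ^ p) ^ p⁻¹ := by
    refine Real.tsum_le_of_sum_le (fun k => mul_nonneg (hb0 k) (hK n k)) fun u => ?_
    refine (Real.inner_le_weight_mul_Lp_of_nonneg u hp.le b (K n) hb0 (hK n)).trans ?_
    have e1 : ∑ i ∈ u, b i ≤ ∑' k, b k := hb.sum_le_tsum u (fun i _ => hb0 i)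
    have e2 : ∑ i ∈ u, b i * K n i ^ p ≤ ∑' k, b k * K n k ^ p :=
      (h1 n).sum_le_tsum u (fun k _ => mul_nonneg (hb0 k) (Real.rpow_nonneg (hK n k) p))
    have e3 : 0 ≤ ∑ i ∈ u, b i := Finset.sum_nonneg fun i _ => hb0 i
    have e4 : 0 ≤ ∑ i ∈ u, b i * K n i ^ p :=
      Finset.sum_nonneg fun k _ => mul_nonneg (hb0 k) (Real.rpow_nonneg (hK n k) p)
    exact mul_le_mul (Real.rpow_le_rpow e3 e1 (by linarith))
      (Real.rpow_le_rpow e4 e2 (by positivity)) (Real.rpow_nonneg e4 _) (Real.rpow_nonneg hB _)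
  calc _ ≤ ((∑' k, b k) ^ (1 - p⁻¹) * (∑' k, b k * K n k ^ p) ^ p⁻¹) ^ p :=
        Real.rpow_le_rpow (tsum_nonneg fun k => mul_nonneg (hb0 k) (hK n k)) this hp0.le
    _ = _ := by
        rw [Real.mul_rpow (Real.rpow_nonneg hB _) (Real.rpow_nonneg hD _),
          Real.rpow_inv_rpow hD hp0.ne']

/-- **Weighted `ℓ_p` estimates for `ξ_n`** (Proposition 3.8): if `0 < θ < 1/2` and
`∑ k^{2θ}|a_k|² < ∞`, then each `ξ_n` is an absolutely convergent series,
`∑_n n^{2θ}|ξ_n|/log(n+1) < ∞`, and `∑_n (n^{2θ}|ξ_n|)^p < ∞` for every `p > 1`. -/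
theorem xi_estimates_sobolev_coefficients
    (θ : ℝ) (hθ0 : 0 < θ) (hθ1 : θ < 1/2)
    (a : ℕ → ℂ) (ha : Summable (fun k : ℕ => (k:ℝ) ^ (2 * θ) * ‖a k‖ ^ 2)) :
    (∀ n : ℕ, 1 ≤ n → Summable (fun k : ℕ => ‖xiTerm a n k‖)) ∧
    Summable (fun n : ℕ =>
      ((n:ℝ) + 1) ^ (2 * θ) * ‖xiSeq a (n + 1)‖ / Real.log ((n:ℝ) + 2)) ∧
    ∀ p : ℝ, 1 < p →
      Summable (fun n : ℕ => (((n:ℝ) + 1) ^ (2 * θ) * ‖xiSeq a (n + 1)‖) ^ p) := by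
  have hs0 : 0 < 2 * θ := by linarith
  have hs1 : 2 * θ < 1 := by linarith
  generalize 2 * θ = s at *
  set b : ℕ → ℝ := fun k => (k:ℝ) ^ s * ‖a k‖ ^ 2 with hbdef
  have hb0 : ∀ k, 0 ≤ b k := fun k => by simp only [hbdef]; positivity
  have hshift (g : ℕ → ℝ) (C : ℝ) (h : ∀ S : Finset ℕ, (∀ n ∈ S, 1 ≤ n) → ∑ n ∈ S, g n ≤ C)
      (N : ℕ) : ∑ n ∈ Finset.range N, g (n + 1) ≤ C := by
    rw [← Finset.sum_image (f := g) (g := fun n => n + 1) (fun x _ y _ h => by simpa using h)]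
    apply h
    intro n hn
    simp only [Finset.mem_image] at hn
    obtain ⟨m, _, rfl⟩ := hn
    omega
  obtain ⟨C, hC⟩ := xiK_sum_log s hs0 hs1
  have hlog : ∀ n : ℕ, 0 < Real.log (((n + 1 : ℕ):ℝ) + 1) := fun n =>
    Real.log_pos (by push_cast; linarith [(Nat.cast_nonneg n : (0:ℝ) ≤ n)])
  obtain ⟨hA, hB⟩ := schur_one b hb0 ha
    (fun n k => xiK s (n + 1) k / Real.log (((n + 1 : ℕ):ℝ) + 1))
    (fun n k => div_nonneg (xiK_nonneg _ _ _) (hlog n).le) C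
    (fun N k => hshift (fun n => xiK s n k / Real.log ((n:ℝ) + 1)) C (fun S hS => hC S hS k) N)
  have hA' : ∀ n, Summable fun k => b k * xiK s (n + 1) k := fun n => by
    refine ((hA n).mul_right (Real.log (((n + 1 : ℕ):ℝ) + 1))).congr fun k => ?_
    have := (hlog n).ne'
    field_simp
  have hT : ∀ n : ℕ, Summable (fun k : ℕ => ‖xiTerm a (n + 1) k‖) := fun n => by
    have hpos : (0:ℝ) < ((n + 1 : ℕ):ℝ) ^ s := by positivity
    rw [← summable_mul_left_iff hpos.ne']
    exact (hA' n).congr fun k => (xiTerm_eq s a (n + 1) k (by omega)).symm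
  have hX : ∀ n : ℕ, ((n:ℝ) + 1) ^ s * ‖xiSeq a (n + 1)‖ ≤ ∑' k, b k * xiK s (n + 1) k := fun n => by
    have : ∑' k, b k * xiK s (n + 1) k = ((n + 1 : ℕ):ℝ) ^ s * ∑' k, ‖xiTerm a (n + 1) k‖ := by
      rw [← tsum_mul_left]
      exact tsum_congr fun k => (xiTerm_eq s a (n + 1) k (by omega)).symm
    rw [this]
    push_cast
    exact mul_le_mul_of_nonneg_left (norm_tsum_le_tsum_norm (hT n)) (by positivity)
  refine ⟨?_, ?_, ?_⟩
  · intro n hn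
    obtain ⟨m, rfl⟩ : ∃ m, n = m + 1 := ⟨n - 1, by omega⟩
    exact hT m
  · refine Summable.of_nonneg_of_le (fun n => ?_) (fun n => ?_) hB
    · have : 0 ≤ Real.log ((n:ℝ) + 2) :=
        Real.log_nonneg (by linarith [(Nat.cast_nonneg n : (0:ℝ) ≤ n)])
      positivity
    · have e : ((n + 1 : ℕ):ℝ) + 1 = (n:ℝ) + 2 := by push_cast; ring
      have hl := hlog n
      rw [e] at hl ⊢
      simp only [← mul_div_assoc]
      rw [tsum_div_const]
      exact div_le_div_of_nonneg_right (hX n) hl.le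
  · intro p hp
    obtain ⟨D, hD⟩ := xiK_sum_p s hs0 hs1 p hp
    refine Summable.of_nonneg_of_le (fun n => by positivity)
      (fun n => Real.rpow_le_rpow (by positivity) (hX n) (by linarith))
      (schur_p b hb0 ha (fun n k => xiK s (n + 1) k) (fun n k => xiK_nonneg _ _ _) p hp D
        (fun N k => hshift (fun n => xiK s n k ^ p) D (fun S hS => hD S hS k) N))
end

section
/- There exists a continuous real-valued function u on [0,π] (for instance u(x) = ∑_{p=1}^∞ p^{−2}·cos(2·2^{p⁴}·x), which converges uniformly) such that, with a_k := (2/π)·∫₀^π u(t)·cos(kt) dt its cosine Fourier coefficients and ξ_n := ∑_{k≥1, k≠2n} a_k²·( 1/(2n+k) + 1/(2n−k) − 1/n ) for n ≥ 1, the series ∑_{n=1}^∞ |ξ_n| diverges. -/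
open Set

/-- Cosine Fourier coefficients `a_k = (2/π)∫₀^π u(t) cos(kt) dt` of a real function. -/
noncomputable def cosCoeff (u : ℝ → ℝ) (k : ℕ) : ℝ :=
  (2 / Real.pi) * ∫ t in (0:ℝ)..Real.pi, u t * Real.cos ((k:ℝ) * t)

/-- Term of the series `ξ_n = ∑_{k≥1, k≠2n} a_k² (1/(2n+k) + 1/(2n−k) − 1/n)` (real case). -/
noncomputable def xiTermR (a : ℕ → ℝ) (n k : ℕ) : ℝ :=
  if k = 0 ∨ k = 2 * n then 0
  else (a k) ^ 2 * (1 / (2 * (n:ℝ) + k) + 1 / (2 * (n:ℝ) - k) - 1 / (n:ℝ))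

/-- `ξ_n = ∑_{k≥1, k≠2n} a_k² (1/(2n+k) + 1/(2n−k) − 1/n)` (real case). -/
noncomputable def xiSeqR (a : ℕ → ℝ) (n : ℕ) : ℝ := ∑' k : ℕ, xiTermR a n k

/-- Frequencies. -/
def frq (p : ℕ) : ℕ := 2 ^ (8 ^ p)

lemma frq_pos (p : ℕ) : 0 < frq p := by unfold frq; positivity

lemma frq_mono : StrictMono frq := by
  intro p q h
  exact Nat.pow_lt_pow_right (by norm_num) (Nat.pow_lt_pow_right (by norm_num) h)

lemma frq_gap {p q : ℕ} (h : p < q) : 4 * frq p ≤ frq q := by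
  unfold frq
  have h1 : 8 ^ p + 2 ≤ 8 ^ q := by
    have : 8 ^ (p + 1) ≤ 8 ^ q := Nat.pow_le_pow_right (by norm_num) h
    have h2 : 0 < 8 ^ p := by positivity
    rw [pow_succ] at this
    omega
  calc 4 * 2 ^ (8 ^ p) = 2 ^ (8 ^ p + 2) := by rw [pow_add]; ring
    _ ≤ _ := Nat.pow_le_pow_right (by norm_num) h1

/-- The potential. -/
noncomputable def pot (t : ℝ) : ℝ :=
  ∑' p : ℕ, (1 / 2 : ℝ) ^ p * Real.cos (((2 * frq p : ℕ) : ℝ) * t)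

lemma sum_half : Summable (fun p : ℕ => (1 / 2 : ℝ) ^ p) :=
  summable_geometric_of_lt_one (by norm_num) (by norm_num)

lemma pot_term_bound (p : ℕ) (x : ℝ) : ‖(1 / 2 : ℝ) ^ p * Real.cos x‖ ≤ (1 / 2 : ℝ) ^ p := by
  rw [norm_mul, Real.norm_of_nonneg (by positivity : (0 : ℝ) ≤ (1 / 2 : ℝ) ^ p)]
  exact mul_le_of_le_one_right (by positivity) (Real.abs_cos_le_one _)

lemma pot_cont : Continuous pot := by
  refine continuous_tsum (fun p => by fun_prop) sum_half (fun p x => pot_term_bound p _)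

lemma int_cos_int (m : ℤ) (hm : m ≠ 0) :
    ∫ t in (0:ℝ)..Real.pi, Real.cos ((m:ℝ) * t) = 0 := by
  have hm' : (m : ℝ) ≠ 0 := by exact_mod_cast hm
  rw [intervalIntegral.integral_comp_mul_left (fun x => Real.cos x) hm']
  simp [Real.sin_int_mul_pi]

lemma int_cos_cos (m k : ℕ) (hm : 0 < m) :
    ∫ t in (0:ℝ)..Real.pi, Real.cos ((m:ℝ) * t) * Real.cos ((k:ℝ) * t)
      = if m = k then Real.pi / 2 else 0 := by
  have h : ∀ t : ℝ, Real.cos ((m:ℝ) * t) * Real.cos ((k:ℝ) * t) =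
      (1 / 2) * Real.cos ((((m:ℤ) - k : ℤ) : ℝ) * t)
        + (1 / 2) * Real.cos ((((m:ℤ) + k : ℤ) : ℝ) * t) := by
    intro t
    push_cast
    rw [sub_mul, add_mul, Real.cos_sub, Real.cos_add]
    ring
  simp_rw [h]
  rw [intervalIntegral.integral_add
    (Continuous.intervalIntegrable (by fun_prop) _ _)
    (Continuous.intervalIntegrable (by fun_prop) _ _),
    intervalIntegral.integral_const_mul, intervalIntegral.integral_const_mul,
    int_cos_int ((m:ℤ) + k) (by omega)]
  split_ifs with hmk
  · subst hmk
    simp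
    ring
  · rw [int_cos_int ((m:ℤ) - k) (by omega)]
    simp

lemma cosCoeff_pot (k : ℕ) :
    HasSum (fun p : ℕ => if 2 * frq p = k then (1 / 2 : ℝ) ^ p else 0) (cosCoeff pot k) := by
  let f : ℕ → C(ℝ, ℝ) := fun p =>
    ⟨fun t => (1 / 2 : ℝ) ^ p * Real.cos (((2 * frq p : ℕ) : ℝ) * t) * Real.cos ((k:ℝ) * t),
      by fun_prop⟩
  have hb : ∀ (p : ℕ) (t : ℝ), ‖f p t‖ ≤ (1 / 2 : ℝ) ^ p := by
    intro p t
    change ‖(1 / 2 : ℝ) ^ p * Real.cos (((2 * frq p : ℕ) : ℝ) * t) * Real.cos ((k:ℝ) * t)‖ ≤ _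
    rw [norm_mul]
    exact (mul_le_of_le_one_right (norm_nonneg _) (Real.abs_cos_le_one _)).trans
      (pot_term_bound p _)
  have hs : HasSum (fun p => ∫ t in (0:ℝ)..Real.pi, f p t)
      (∫ t in (0:ℝ)..Real.pi, ∑' p, f p t) := by
    refine intervalIntegral.hasSum_intervalIntegral_of_summable_norm (f := f) ?_
    refine Summable.of_nonneg_of_le (fun p => norm_nonneg _) (fun p => ?_) sum_half
    rw [ContinuousMap.norm_le _ (by positivity)]
    exact fun x => hb p x
  have h2 : ∀ t, ∑' p, f p t = pot t * Real.cos ((k:ℝ) * t) := by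
    intro t
    change ∑' p : ℕ, (1 / 2 : ℝ) ^ p * Real.cos (((2 * frq p : ℕ) : ℝ) * t)
      * Real.cos ((k:ℝ) * t) = _
    rw [tsum_mul_right]
    rfl
  simp_rw [h2] at hs
  have hs' := hs.mul_left (2 / Real.pi)
  unfold cosCoeff
  refine (congrArg (fun g => HasSum g _) (funext fun p => ?_)).mpr hs'
  change _ = 2 / Real.pi * ∫ t in (0:ℝ)..Real.pi,
    (1 / 2 : ℝ) ^ p * Real.cos (((2 * frq p : ℕ) : ℝ) * t) * Real.cos ((k:ℝ) * t)
  simp_rw [mul_assoc ((1 / 2 : ℝ) ^ p)]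
  rw [intervalIntegral.integral_const_mul,
    int_cos_cos (2 * frq p) k (by have := frq_pos p; omega)]
  split_ifs
  · field_simp
  · simp

lemma coeff_frq (p : ℕ) : cosCoeff pot (2 * frq p) = (1 / 2 : ℝ) ^ p := by
  refine (cosCoeff_pot _).unique ?_
  convert hasSum_ite_eq p ((1 / 2 : ℝ) ^ p) using 2 with q
  by_cases h : q = p
  · simp [h]
  · have : frq q ≠ frq p := fun h' => h (frq_mono.injective h')
    simp [h, this]

lemma coeff_zero (k : ℕ) (h : ∀ p, 2 * frq p ≠ k) : cosCoeff pot k = 0 := by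
  refine (cosCoeff_pot _).unique ?_
  simp [h]

lemma sq_summable : Summable (fun k : ℕ => (cosCoeff pot k) ^ 2) := by
  have hi : Function.Injective (fun p => 2 * frq p) := by
    intro p q h
    exact frq_mono.injective (by simpa using h)
  rw [← hi.summable_iff]
  · have : ((fun k : ℕ => (cosCoeff pot k) ^ 2) ∘ fun p => 2 * frq p)
        = fun p : ℕ => (1 / 4 : ℝ) ^ p := by
      ext p
      simp only [Function.comp, coeff_frq]
      rw [← pow_mul, mul_comm, pow_mul]
      norm_num
    rw [this]
    exact summable_geometric_of_lt_one (by norm_num) (by norm_num)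
  · intro k hk
    rw [coeff_zero k (fun p hp => hk ⟨p, hp⟩)]
    simp

lemma xi_bound (a : ℕ → ℝ) (n k : ℕ) (hn : 1 ≤ n) : |xiTermR a n k| ≤ 3 * a k ^ 2 := by
  unfold xiTermR
  split_ifs with h
  · simp; positivity
  · push Not at h
    have hn' : (1:ℝ) ≤ n := by exact_mod_cast hn
    have hk : (0:ℝ) ≤ k := by positivity
    rw [abs_mul, abs_of_nonneg (sq_nonneg _), mul_comm]
    refine mul_le_mul_of_nonneg_right ?_ (sq_nonneg _)
    have h1 : |1 / (2 * (n:ℝ) + k)| ≤ 1 := by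
      rw [abs_of_nonneg (by positivity), div_le_one (by positivity)]
      linarith
    have h2 : |1 / (2 * (n:ℝ) - k)| ≤ 1 := by
      have h3 : (1:ℝ) ≤ |2 * (n:ℝ) - k| := by
        have : (1:ℤ) ≤ |2 * (n:ℤ) - k| := Int.one_le_abs (by omega)
        exact_mod_cast this
      rw [abs_div, abs_one, div_le_one (by linarith)]
      exact h3
    have h4 : |1 / (n:ℝ)| ≤ 1 := by
      rw [abs_of_nonneg (by positivity), div_le_one (by positivity)]
      linarith
    rw [abs_le] at *
    constructor <;> linarith [h1.1, h1.2, h2.1, h2.2, h4.1, h4.2]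

lemma kernel_eq (n k : ℝ) (hn : 0 < n) (hk : 0 ≤ k) (h : 2 * n - k ≠ 0) :
    1 / (2 * n + k) + 1 / (2 * n - k) - 1 / n = k ^ 2 / (n * (2 * n + k) * (2 * n - k)) := by
  have : 2 * n + k ≠ 0 := by positivity
  field_simp
  ring

lemma xi_lower (p j k : ℕ) (hj : j < frq p) :
    (if k = 2 * frq p then (1 / 4 : ℝ) ^ p * (1 / 6 * (1 / ((j:ℝ) + 1))) else 0)
      - 2 / (frq p : ℝ) * (cosCoeff pot k) ^ 2
      ≤ xiTermR (cosCoeff pot) (frq p + j + 1) k := by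
  have hN : (0:ℝ) < frq p := by exact_mod_cast frq_pos p
  have hj' : (j:ℝ) + 1 ≤ frq p := by exact_mod_cast hj
  have hj0 : (0:ℝ) ≤ j := by positivity
  by_cases hk : k = 2 * frq p
  · subst hk
    have hx : xiTermR (cosCoeff pot) (frq p + j + 1) (2 * frq p) = (1 / 4 : ℝ) ^ p *
      ((2 * (frq p : ℝ)) ^ 2 / (((frq p : ℝ) + j + 1) * (2 * ((frq p : ℝ) + j + 1)
        + 2 * frq p) * (2 * ((frq p : ℝ) + j + 1) - 2 * frq p))) := by
      unfold xiTermR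
      rw [if_neg (by have := frq_pos p; omega), coeff_frq,
        kernel_eq _ _ (by positivity) (by positivity) (by push_cast; intro h; linarith)]
      rw [← pow_mul, mul_comm p 2, pow_mul]
      push_cast
      norm_num
    rw [hx, if_pos rfl]
    have h0 : 0 ≤ 2 / (frq p : ℝ) * (cosCoeff pot (2 * frq p)) ^ 2 := by positivity
    refine (sub_le_self _ h0).trans ?_
    refine mul_le_mul_of_nonneg_left ?_ (by positivity)
    have e : (2 * ((frq p : ℝ) + j + 1) - 2 * frq p) = 2 * (j + 1) := by ring
    rw [e, one_div_mul_one_div, div_le_div_iff₀ (by positivity) (by positivity)]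
    generalize (frq p : ℝ) = N at *
    have : 0 ≤ (j + 1 : ℝ) * (24 * N ^ 2 - (N + j + 1) * (2 * (N + j + 1) + 2 * N) * 2) := by
      refine mul_nonneg (by positivity) ?_
      nlinarith
    nlinarith
  · rw [if_neg hk, zero_sub]
    by_cases h0 : cosCoeff pot k = 0
    · unfold xiTermR
      simp [h0]
    unfold xiTermR
    split_ifs with h
    · have : 0 ≤ 2 / (frq p : ℝ) * (cosCoeff pot k) ^ 2 := by positivity
      linarith
    push Not at h
    have hne : 2 * ((frq p + j + 1 : ℕ) : ℝ) - k ≠ 0 := by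
      intro h'
      have h3 : ((k:ℕ):ℝ) = ((2 * (frq p + j + 1) : ℕ) : ℝ) := by
        push_cast at h' ⊢; linarith
      exact h.2 (by exact_mod_cast h3)
    rw [kernel_eq _ _ (by positivity) (by positivity) hne, ← neg_mul, mul_comm]
    refine mul_le_mul_of_nonneg_left ?_ (sq_nonneg _)
    obtain ⟨q, hq⟩ : ∃ q, 2 * frq q = k := by
      by_contra! hc
      exact h0 (coeff_zero k hc)
    have hk0 : (0:ℝ) < k := by
      have := h.1
      positivity
    rcases lt_trichotomy p q with hpq | hpq | hpq
    · have hg := frq_gap hpq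
      have hg' : 8 * (frq p : ℝ) ≤ k := by
        have : 8 * frq p ≤ k := by omega
        exact_mod_cast this
      have hnN : (frq p : ℝ) ≤ ((frq p + j + 1 : ℕ) : ℝ) := by push_cast; linarith
      have hnk : 4 * ((frq p + j + 1 : ℕ) : ℝ) ≤ k := by push_cast; linarith
      generalize ((frq p + j + 1 : ℕ) : ℝ) = n at *
      generalize (k : ℝ) = K at *
      have hn : 0 < n := by linarith
      have hkk : 0 < K - 2 * n := by linarith
      have e : K ^ 2 / (n * (2 * n + K) * (2 * n - K))
          = - (K ^ 2 / (n * (2 * n + K) * (K - 2 * n))) := by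
        rw [← div_neg]; congr 1; ring
      rw [e, neg_le_neg_iff]
      calc K ^ 2 / (n * (2 * n + K) * (K - 2 * n)) ≤ 2 / n := by
            rw [div_le_div_iff₀ (by positivity) hn]
            have : 0 ≤ n * (2 * ((2 * n + K) * (K - 2 * n)) - K ^ 2) :=
              mul_nonneg hn.le (by nlinarith)
            nlinarith
        _ ≤ 2 / (frq p : ℝ) := by gcongr
    · subst hpq; exact absurd hq.symm hk
    · have hlt := frq_mono hpq
      have : (k:ℝ) < 2 * ((frq p + j + 1 : ℕ) : ℝ) := by
        have : k < 2 * (frq p + j + 1) := by omega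
        exact_mod_cast this
      have h5 : 0 < 2 * ((frq p + j + 1 : ℕ) : ℝ) - k := by linarith
      have h6 : 0 ≤ 2 / (frq p : ℝ) := by positivity
      exact (neg_nonpos.mpr h6).trans (by positivity)

lemma xi_summable (n : ℕ) (hn : 1 ≤ n) :
    Summable (fun k : ℕ => |xiTermR (cosCoeff pot) n k|) :=
  Summable.of_nonneg_of_le (fun _ => abs_nonneg _) (fun k => xi_bound _ n k hn)
    (sq_summable.mul_left 3)

lemma xiSeq_lower (p j : ℕ) (hj : j < frq p) :
    (1 / 4 : ℝ) ^ p * (1 / 6 * (1 / ((j:ℝ) + 1)))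
      - 2 / (frq p : ℝ) * ∑' k, (cosCoeff pot k) ^ 2
      ≤ xiSeqR (cosCoeff pot) (frq p + j + 1) := by
  have h1 := (hasSum_ite_eq (2 * frq p) ((1 / 4 : ℝ) ^ p * (1 / 6 * (1 / ((j:ℝ) + 1))))).sub
    (sq_summable.hasSum.mul_left (2 / (frq p : ℝ)))
  exact hasSum_le (fun k => xi_lower p j k hj) h1 (xi_summable _ (by omega)).of_abs.hasSum

lemma harm_lower (m : ℕ) : (m : ℝ) / 2 ≤ ∑ j ∈ Finset.range (2 ^ m), 1 / ((j:ℝ) + 1) := by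
  induction m with
  | zero => simp
  | succ m ih =>
    rw [pow_succ, mul_two, Finset.sum_range_add]
    have : (1:ℝ) / 2 ≤ ∑ x ∈ Finset.range (2 ^ m), 1 / (((2 ^ m + x : ℕ) : ℝ) + 1) := by
      calc (1:ℝ) / 2 = ∑ x ∈ Finset.range (2 ^ m), 1 / (2 * (2:ℝ) ^ m) := by
            simp
        _ ≤ _ := by
            refine Finset.sum_le_sum fun x hx => ?_
            have hx' : (x:ℝ) + 1 ≤ 2 ^ m := by exact_mod_cast Finset.mem_range.mp hx
            apply one_div_le_one_div_of_le (by positivity)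
            push_cast
            linarith
    push_cast at *
    linarith

lemma block_lower (p : ℕ) :
    (2 : ℝ) ^ p / 12 - 2 * ∑' k, (cosCoeff pot k) ^ 2
      ≤ ∑ j ∈ Finset.range (frq p), xiSeqR (cosCoeff pot) (frq p + j + 1) := by
  have hN : (0:ℝ) < frq p := by exact_mod_cast frq_pos p
  refine le_trans ?_ (Finset.sum_le_sum fun j hj => xiSeq_lower p j (Finset.mem_range.mp hj))
  rw [Finset.sum_sub_distrib, ← Finset.mul_sum, ← Finset.mul_sum]
  have h1 := harm_lower (8 ^ p)
  have h2 : (2 : ℝ) ^ p / 12 = (1 / 4 : ℝ) ^ p * (1 / 6 * (((8 ^ p : ℕ) : ℝ) / 2)) := by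
    have : (2:ℝ) ^ p = (1 / 4) ^ p * 8 ^ p := by rw [← mul_pow]; norm_num
    push_cast
    rw [this]
    ring
  have h3 : ∑ j ∈ Finset.range (frq p), 2 / (frq p : ℝ) * ∑' k, (cosCoeff pot k) ^ 2
      = 2 * ∑' k, (cosCoeff pot k) ^ 2 := by
    rw [Finset.sum_const, Finset.card_range, nsmul_eq_mul]
    field_simp
  rw [h3, h2]
  refine sub_le_sub_right ?_ _
  refine mul_le_mul_of_nonneg_left ?_ (by positivity)
  exact mul_le_mul_of_nonneg_left h1 (by norm_num)

theorem exists_continuous_potential_xi_not_summable :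
    ∃ u : ℝ → ℝ, ContinuousOn u (Icc 0 Real.pi) ∧
      Summable (fun k : ℕ => (cosCoeff u k) ^ 2) ∧
      (∀ n : ℕ, 1 ≤ n → Summable (fun k : ℕ => |xiTermR (cosCoeff u) n k|)) ∧
      ¬ Summable (fun n : ℕ => |xiSeqR (cosCoeff u) (n + 1)|) := by
  refine ⟨pot, pot_cont.continuousOn, sq_summable, xi_summable, fun hs => ?_⟩
  set S := ∑' k, (cosCoeff pot k) ^ 2 with hS
  set T := ∑' n, |xiSeqR (cosCoeff pot) (n + 1)| with hT
  obtain ⟨p, hp⟩ := pow_unbounded_of_one_lt (12 * (T + 2 * S)) (by norm_num : (1:ℝ) < 2)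
  have h1 := block_lower p
  have h2 : ∑ j ∈ Finset.range (frq p), xiSeqR (cosCoeff pot) (frq p + j + 1) ≤ T := by
    calc _ ≤ ∑ j ∈ Finset.range (frq p), |xiSeqR (cosCoeff pot) (frq p + j + 1)| :=
          Finset.sum_le_sum fun j _ => le_abs_self _
      _ ≤ ∑ n ∈ Finset.range (frq p + frq p), |xiSeqR (cosCoeff pot) (n + 1)| := by
          rw [Finset.sum_range_add]
          exact le_add_of_nonneg_left (Finset.sum_nonneg fun _ _ => abs_nonneg _)
      _ ≤ T := hs.sum_le_tsum _ (fun _ _ => abs_nonneg _)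
  linarith
end

section
/- Let α > 0 and let u ∈ L¹((0,π);ℂ), extended to all of ℝ with period π. Define its integral modulus of continuity ω₁(δ) := sup_{0 < t ≤ δ} ∫₀^π |u(x+t) − u(x)| dx. Then there exists M > 0 (depending only on α and u) such that for every z ∈ ℂ with Re z ≥ 1 and |Im z| ≤ α, and every x ∈ [0,π]: |∫₀ˣ u(t)·cos(zt) dt| ≤ M·( ω₁(1/|z|) + 1/|z| ). -/
open MeasureTheory Set

/-- The integral modulus of continuity in `L¹`:
`ω₁(δ) = sup_{0 < t ≤ δ} ∫₀^π |u(x+t) − u(x)| dx`. -/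
noncomputable def integralModulus (u : ℝ → ℂ) (δ : ℝ) : ℝ :=
  sSup ((fun t => ∫ x in (0:ℝ)..Real.pi, ‖u (x + t) - u x‖) '' Ioc 0 δ)

/-- Integrability of a shifted function on a rectangle. -/
lemma oim_prod_integrable (u : ℝ → ℂ) (hii : ∀ a b, IntervalIntegrable u volume a b)
    (h : ℝ) (hh : 0 < h) :
    IntegrableOn (fun p : ℝ × ℝ => u (p.1 + p.2)) (Ioc 0 Real.pi ×ˢ Ioc 0 h)
      (volume.prod volume) := by
  have hpi := Real.pi_pos
  have hf : Integrable ((Ioc 0 (Real.pi + h)).indicator u) := by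
    rw [integrable_indicator_iff measurableSet_Ioc]
    exact (intervalIntegrable_iff_integrableOn_Ioc_of_le (by positivity)).1 (hii _ _)
  have hg : Integrable ((Ioc 0 Real.pi).indicator (fun _ : ℝ => (1:ℂ))) := by
    rw [integrable_indicator_iff measurableSet_Ioc]
    exact integrableOn_const (by simp)
  have h1 := hg.mul_prod hf
  have h2 := (measurePreserving_prod_add (volume : Measure ℝ) (volume : Measure ℝ)).integrable_comp_of_integrable h1
  refine h2.integrableOn.congr_fun ?_ (measurableSet_Ioc.prod measurableSet_Ioc)
  rintro ⟨t, s⟩ ⟨ht, hs⟩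
  simp only [mem_Ioc] at ht hs
  have a1 : t ∈ Ioc 0 Real.pi := ht
  have a2 : t + s ∈ Ioc 0 (Real.pi + h) := ⟨by linarith, by linarith⟩
  simp [Function.comp, a1, indicator_of_mem a2]

/-- Fubini on a triangle (integration by parts). -/
lemma oim_triangle (w c : ℝ → ℂ) (x : ℝ) (hx : 0 ≤ x)
    (hw : IntervalIntegrable w volume 0 x) (hc : Continuous c) :
    ∫ t in (0:ℝ)..x, (∫ s in (0:ℝ)..t, w s) * c t = ∫ s in (0:ℝ)..x, w s * ∫ t in s..x, c t := by
  have hw' : IntegrableOn w (Ioc 0 x) := (intervalIntegrable_iff_integrableOn_Ioc_of_le hx).1 hw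
  have hc' : IntegrableOn c (Ioc 0 x) :=
    (intervalIntegrable_iff_integrableOn_Ioc_of_le hx).1 (hc.intervalIntegrable _ _)
  have hm : MeasurableSet {p : ℝ × ℝ | p.2 ≤ p.1} := measurableSet_le measurable_snd measurable_fst
  have hprod := (Integrable.mul_prod hc' hw').indicator hm
  have key := integral_integral_swap (f := fun t s => {p : ℝ × ℝ | p.2 ≤ p.1}.indicator
    (fun z : ℝ × ℝ => c z.1 * w z.2) (t, s)) hprod
  rw [intervalIntegral.integral_of_le hx, intervalIntegral.integral_of_le hx]
  convert key using 1
  · refine setIntegral_congr_fun measurableSet_Ioc fun t ht => ?_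
    have e : (fun s => {p : ℝ × ℝ | p.2 ≤ p.1}.indicator
      (fun z : ℝ × ℝ => c z.1 * w z.2) (t, s)) = (Iic t).indicator (fun s => c t * w s) := by
      ext s; simp [indicator]
    simp only [e]
    rw [setIntegral_indicator measurableSet_Iic, integral_const_mul,
      intervalIntegral.integral_of_le ht.1.le, mul_comm]
    congr 3
    ext s; simp only [mem_Ioc, mem_inter_iff, mem_Iic]
    exact ⟨fun a => ⟨⟨a.1, a.2.trans ht.2⟩, a.2⟩, fun a => ⟨a.1.1, a.2⟩⟩
  · refine setIntegral_congr_fun measurableSet_Ioc fun s hs => ?_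
    have e : (fun t => {p : ℝ × ℝ | p.2 ≤ p.1}.indicator
      (fun z : ℝ × ℝ => c z.1 * w z.2) (t, s)) = (Ici s).indicator (fun t => c t * w s) := by
      ext t; simp [indicator]
    simp only [e]
    rw [setIntegral_indicator measurableSet_Ici, integral_mul_const,
      intervalIntegral.integral_of_le hs.2, mul_comm, ← integral_Icc_eq_integral_Ioc]
    congr 3
    ext t; simp only [mem_Ioc, mem_inter_iff, mem_Ici, mem_Icc]
    exact ⟨fun a => ⟨⟨hs.1.trans_le a.1, a.2⟩, a.1⟩, fun a => ⟨a.2, a.1.2⟩⟩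

lemma oim_shift (u : ℝ → ℂ) (hii : ∀ a b, IntervalIntegrable u volume a b) (t a b : ℝ) :
    IntervalIntegrable (fun x => u (x + t)) volume a b := by
  have := (hii (a + t) (b + t)).comp_add_right t enorm_ne_top
  simpa using this

lemma oim_le_modulus (u : ℝ → ℂ) (hper : Function.Periodic u Real.pi)
    (hii : ∀ a b, IntervalIntegrable u volume a b) (δ t : ℝ) (ht : t ∈ Ioc 0 δ) :
    ∫ x in (0:ℝ)..Real.pi, ‖u (x + t) - u x‖ ≤ integralModulus u δ := by
  refine le_csSup ⟨2 * ∫ x in (0:ℝ)..Real.pi, ‖u x‖, ?_⟩ (mem_image_of_mem _ ht)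
  rintro _ ⟨s, -, rfl⟩
  have h1 := oim_shift u hii s 0 Real.pi
  have h2 := hii 0 Real.pi
  have h3 : ∫ x in (0:ℝ)..Real.pi, ‖u (x + s)‖ = ∫ x in (0:ℝ)..Real.pi, ‖u x‖ := by
    rw [intervalIntegral.integral_comp_add_right (fun x => ‖u x‖)]
    have hp : Function.Periodic (fun x => ‖u x‖) Real.pi := fun x => by simp [hper x]
    have := hp.intervalIntegral_add_eq s 0
    simpa [add_comm] using this
  calc _ ≤ ∫ x in (0:ℝ)..Real.pi, (‖u (x + s)‖ + ‖u x‖) :=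
        intervalIntegral.integral_mono_on Real.pi_pos.le (h1.sub h2).norm (h1.norm.add h2.norm)
          fun x _ => norm_sub_le _ _
    _ = _ := by rw [intervalIntegral.integral_add h1.norm h2.norm, h3]; ring

/-- Steklov average. -/
noncomputable def oimAvg (u : ℝ → ℂ) (h t : ℝ) : ℂ := (h:ℂ)⁻¹ * ∫ s in (0:ℝ)..h, u (t + s)

lemma oimAvg_eq (u : ℝ → ℂ) (hii : ∀ a b, IntervalIntegrable u volume a b) (h t : ℝ) :
    oimAvg u h t = oimAvg u h 0 + ∫ s in (0:ℝ)..t, (h:ℂ)⁻¹ * (u (s + h) - u s) := by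
  unfold oimAvg
  rw [intervalIntegral.integral_const_mul, ← mul_add]
  congr 1
  rw [intervalIntegral.integral_sub (oim_shift u hii h 0 t) (hii 0 t),
    intervalIntegral.integral_comp_add_left u, intervalIntegral.integral_comp_add_left u,
    intervalIntegral.integral_comp_add_right u]
  have e1 := intervalIntegral.integral_add_adjacent_intervals (hii 0 t) (hii t (t + h))
  have e2 := intervalIntegral.integral_add_adjacent_intervals (hii 0 h) (hii h (t + h))
  simp only [add_zero, zero_add]
  linear_combination e1 - e2

lemma oimAvg_continuous (u : ℝ → ℂ) (hii : ∀ a b, IntervalIntegrable u volume a b) (h : ℝ) :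
    Continuous (oimAvg u h) := by
  have : oimAvg u h = fun t => oimAvg u h 0 + ∫ s in (0:ℝ)..t, (h:ℂ)⁻¹ * (u (s + h) - u s) :=
    funext (oimAvg_eq u hii h)
  rw [this]
  exact continuous_const.add (intervalIntegral.continuous_primitive
    (fun a b => ((oim_shift u hii h a b).sub (hii a b)).const_mul _) 0)

lemma oimAvg_L1 (u : ℝ → ℂ) (hper : Function.Periodic u Real.pi)
    (hii : ∀ a b, IntervalIntegrable u volume a b) (h : ℝ) (hh : 0 < h) :
    ∫ t in (0:ℝ)..Real.pi, ‖u t - oimAvg u h t‖ ≤ integralModulus u h := by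
  have hpi := Real.pi_pos
  have hP := oim_prod_integrable u hii h hh
  rw [IntegrableOn, ← Measure.prod_restrict] at hP
  have hu1 : IntegrableOn u (Ioc 0 Real.pi) :=
    (intervalIntegrable_iff_integrableOn_Ioc_of_le hpi.le).1 (hii _ _)
  have hQ : Integrable (fun p : ℝ × ℝ => u p.1)
      ((volume.restrict (Ioc 0 Real.pi)).prod (volume.restrict (Ioc 0 h))) :=
    Integrable.comp_fst hu1 _
  have hD := (hP.sub hQ).norm
  have swap := integral_integral_swap (f := fun t s => ‖u (t + s) - u t‖) hD
  have hin := hD.integral_prod_left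
  have pt : ∀ t, ‖u t - oimAvg u h t‖ ≤ h⁻¹ * ∫ s in (0:ℝ)..h, ‖u (t + s) - u t‖ := by
    intro t
    have hs : IntervalIntegrable (fun s => u (t + s)) volume 0 h := by
      simpa [add_comm] using oim_shift u hii t 0 h
    have e : oimAvg u h t - u t = (h:ℂ)⁻¹ * ∫ s in (0:ℝ)..h, (u (t + s) - u t) := by
      have : (h:ℂ) ≠ 0 := by exact_mod_cast hh.ne'
      rw [intervalIntegral.integral_sub hs (by simp), intervalIntegral.integral_const, oimAvg]
      simp
      field_simp
    rw [norm_sub_rev, e, norm_mul]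
    have : ‖(h:ℂ)⁻¹‖ = h⁻¹ := by simp [abs_of_pos hh]
    rw [this]
    gcongr
    exact intervalIntegral.norm_integral_le_integral_norm hh.le
  have hin' : IntervalIntegrable (fun t => ∫ s in (0:ℝ)..h, ‖u (t + s) - u t‖) volume 0 Real.pi := by
    rw [intervalIntegrable_iff_integrableOn_Ioc_of_le hpi.le]
    simp_rw [intervalIntegral.integral_of_le hh.le]
    exact hin
  calc _ ≤ ∫ t in (0:ℝ)..Real.pi, h⁻¹ * ∫ s in (0:ℝ)..h, ‖u (t + s) - u t‖ :=
        intervalIntegral.integral_mono_on hpi.le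
          ((hii _ _).sub ((oimAvg_continuous u hii h).intervalIntegrable _ _)).norm
          (hin'.const_mul _) fun t _ => pt t
    _ = h⁻¹ * ∫ s in (0:ℝ)..h, ∫ t in (0:ℝ)..Real.pi, ‖u (t + s) - u t‖ := by
        rw [intervalIntegral.integral_const_mul]
        simp_rw [intervalIntegral.integral_of_le hh.le, intervalIntegral.integral_of_le hpi.le]
        rw [swap]
    _ ≤ h⁻¹ * ∫ s in (0:ℝ)..h, integralModulus u h := by
        gcongr
        simp_rw [intervalIntegral.integral_of_le hh.le, intervalIntegral.integral_of_le hpi.le]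
        refine setIntegral_mono_on hD.integral_prod_right (integrableOn_const (by simp))
          measurableSet_Ioc fun s hs => ?_
        have := oim_le_modulus u hper hii h s hs
        rwa [intervalIntegral.integral_of_le hpi.le] at this
    _ = _ := by
        rw [intervalIntegral.integral_const]
        simp
        field_simp

lemma oim_w_bound (u : ℝ → ℂ) (hper : Function.Periodic u Real.pi)
    (hii : ∀ a b, IntervalIntegrable u volume a b) (h : ℝ) (hh : 0 < h)
    (x : ℝ) (hx : x ∈ Icc 0 Real.pi) :
    ∫ s in (0:ℝ)..x, ‖(h:ℂ)⁻¹ * (u (s + h) - u s)‖ ≤ h⁻¹ * integralModulus u h := by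
  have e : ∀ s, ‖(h:ℂ)⁻¹ * (u (s + h) - u s)‖ = h⁻¹ * ‖u (s + h) - u s‖ := by
    intro s; simp [abs_of_pos hh]
  simp_rw [e]
  rw [intervalIntegral.integral_const_mul]
  gcongr
  refine le_trans ?_ (oim_le_modulus u hper hii h h ⟨hh, le_rfl⟩)
  exact intervalIntegral.integral_mono_interval le_rfl hx.1 hx.2
    (Filter.Eventually.of_forall fun _ => norm_nonneg _)
    ((oim_shift u hii h _ _).sub (hii _ _)).norm

lemma oimAvg_bound (u : ℝ → ℂ) (hper : Function.Periodic u Real.pi)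
    (hii : ∀ a b, IntervalIntegrable u volume a b) (h : ℝ) (hh : 0 < h) (hh1 : h ≤ 1) :
    h * ‖oimAvg u h 0‖ ≤ 2 * integralModulus u h + h * ∫ t in (0:ℝ)..Real.pi, ‖u t‖ := by
  have hpi := Real.pi_pos
  set ω := integralModulus u h with hω
  set I := ∫ t in (0:ℝ)..Real.pi, ‖u t‖
  have hL := oimAvg_L1 u hper hii h hh
  have hω0 : 0 ≤ ω :=
    le_trans (intervalIntegral.integral_nonneg hpi.le fun _ _ => norm_nonneg _) hL
  have hI0 : 0 ≤ I := intervalIntegral.integral_nonneg hpi.le fun _ _ => norm_nonneg _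
  have hvi := (oimAvg_continuous u hii h).intervalIntegrable (μ := volume) 0 Real.pi
  have pt : ∀ t ∈ Icc 0 Real.pi,
      ‖oimAvg u h 0‖ ≤ (‖u t‖ + ‖u t - oimAvg u h t‖) + h⁻¹ * ω := by
    intro t ht
    have e : oimAvg u h 0 = u t - (u t - oimAvg u h t)
        - ∫ s in (0:ℝ)..t, (h:ℂ)⁻¹ * (u (s + h) - u s) := by
      have := oimAvg_eq u hii h t
      linear_combination -this
    have b := (intervalIntegral.norm_integral_le_integral_norm (μ := volume)
      (f := fun s => (h:ℂ)⁻¹ * (u (s + h) - u s)) ht.1).trans (oim_w_bound u hper hii h hh t ht)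
    calc ‖oimAvg u h 0‖ ≤ ‖u t - (u t - oimAvg u h t)‖
          + ‖∫ s in (0:ℝ)..t, (h:ℂ)⁻¹ * (u (s + h) - u s)‖ := by
            conv_lhs => rw [e]
            exact norm_sub_le _ _
      _ ≤ _ := add_le_add (norm_sub_le _ _) b
  have hdi := ((hii 0 Real.pi).sub hvi).norm
  have hui := (hii 0 Real.pi).norm
  have := intervalIntegral.integral_mono_on hpi.le (by simp) ((hui.add hdi).add (by simp)) pt
  rw [intervalIntegral.integral_add (hui.add hdi) (by simp),
    intervalIntegral.integral_add hui hdi, intervalIntegral.integral_const,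
    intervalIntegral.integral_const] at this
  simp only [sub_zero, smul_eq_mul] at this
  have h3 : Real.pi * (h * ‖oimAvg u h 0‖) ≤ Real.pi * (2 * ω + h * I) := by
    have h4 := mul_le_mul_of_nonneg_left this hh.le
    have h5 : h * (Real.pi * (h⁻¹ * ω)) = Real.pi * ω := by field_simp
    have h6 : h * (∫ t in (0:ℝ)..Real.pi, ‖u t - oimAvg u h t‖) ≤ 1 * ω :=
      mul_le_mul hh1 hL (intervalIntegral.integral_nonneg hpi.le fun _ _ => norm_nonneg _) zero_le_one
    have h7 : (1:ℝ) ≤ Real.pi := by linarith [Real.pi_gt_three]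
    have h8 := mul_le_mul_of_nonneg_right h7 (mul_nonneg hh.le hI0)
    have h9 := mul_le_mul_of_nonneg_right h7 hω0
    nlinarith
  exact le_of_mul_le_mul_left h3 hpi

lemma oim_exp_bound (α : ℝ) (z : ℂ) (hz : |z.im| ≤ α) (t : ℝ) (ht : t ∈ Icc 0 Real.pi) :
    ‖Complex.cos (z * t)‖ ≤ Real.exp (α * Real.pi) ∧
    ‖Complex.sin (z * t)‖ ≤ Real.exp (α * Real.pi) := by
  have hb : |z.im| * t ≤ α * Real.pi :=
    mul_le_mul hz ht.2 ht.1 ((abs_nonneg _).trans hz)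
  have e1 : ‖Complex.exp (z * t * Complex.I)‖ ≤ Real.exp (α * Real.pi) := by
    rw [Complex.norm_exp]; gcongr
    simp
    nlinarith [neg_abs_le z.im, ht.1]
  have e2 : ‖Complex.exp (-(z * t) * Complex.I)‖ ≤ Real.exp (α * Real.pi) := by
    rw [Complex.norm_exp]; gcongr
    simp
    nlinarith [le_abs_self z.im, ht.1]
  constructor
  · rw [Complex.cos, norm_div]
    have := norm_add_le (Complex.exp (z * t * Complex.I)) (Complex.exp (-(z * t) * Complex.I))
    simp only [Complex.norm_ofNat]
    linarith
  · rw [Complex.sin, norm_div, norm_mul]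
    have := norm_sub_le (Complex.exp (-(z * t) * Complex.I)) (Complex.exp (z * t * Complex.I))
    simp only [Complex.norm_ofNat, Complex.norm_I]
    linarith

/-- **Oscillatory integral estimate via the integral modulus of continuity** (estimate
(3.e) in the paper): for a `π`-periodic `u ∈ L¹(0,π)` there is `M > 0` such that for all
`z` with `Re z ≥ 1`, `|Im z| ≤ α`, and all `x ∈ [0,π]`,
`|∫₀ˣ u(t) cos(zt) dt| ≤ M (ω₁(1/|z|) + 1/|z|)`. -/
theorem oscillatory_integral_modulus_estimate
    (α : ℝ) (hα : 0 < α) (u : ℝ → ℂ)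
    (hper : Function.Periodic u Real.pi)
    (hint : IntegrableOn u (Ioo 0 Real.pi)) :
    ∃ M > (0:ℝ), ∀ z : ℂ, 1 ≤ z.re → |z.im| ≤ α →
      ∀ x ∈ Icc (0:ℝ) Real.pi,
        ‖∫ t in (0:ℝ)..x, u t * Complex.cos (z * t)‖ ≤
          M * (integralModulus u (1 / ‖z‖) + 1 / ‖z‖) := by
  have hpi := Real.pi_pos
  have hii : ∀ a b, IntervalIntegrable u volume a b := by
    refine hper.intervalIntegrable₀ hpi.ne' ?_
    rw [intervalIntegrable_iff_integrableOn_Ioo_of_le hpi.le]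
    exact hint
  set I := ∫ t in (0:ℝ)..Real.pi, ‖u t‖ with hI
  have hI0 : 0 ≤ I := intervalIntegral.integral_nonneg hpi.le fun _ _ => norm_nonneg _
  set C := Real.exp (α * Real.pi) with hC
  have hC0 : 0 < C := Real.exp_pos _
  refine ⟨C * (7 + 2 * I), by positivity, fun z hz1 hz2 x hx => ?_⟩
  have hzn : 1 ≤ ‖z‖ := hz1.trans (Complex.re_le_norm z)
  have hz0 : z ≠ 0 := by rintro rfl; simp at hzn; linarith
  set h := 1 / ‖z‖ with hhdef
  have hh : 0 < h := by positivity
  have hh1 : h ≤ 1 := by rw [hhdef, div_le_one (by linarith)]; exact hzn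
  set ω := integralModulus u h with hω
  have hL := oimAvg_L1 u hper hii h hh
  have hω0 : 0 ≤ ω :=
    le_trans (intervalIntegral.integral_nonneg hpi.le fun _ _ => norm_nonneg _) hL
  have hcc : Continuous fun t : ℝ => Complex.cos (z * t) := by fun_prop
  have hvc := oimAvg_continuous u hii h
  have hprim : ∀ s ∈ Icc 0 x, ‖∫ t in s..x, Complex.cos (z * t)‖ ≤ 2 * C * h := by
    intro s hs
    rw [integral_cos_mul_complex hz0, ← sub_div, norm_div]
    have a := (oim_exp_bound α z hz2 x hx).2
    have b := (oim_exp_bound α z hz2 s ⟨hs.1, hs.2.trans hx.2⟩).2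
    have := norm_sub_le (Complex.sin (z * x)) (Complex.sin (z * s))
    rw [hhdef, mul_one_div]
    gcongr
    linarith
  set w : ℝ → ℂ := fun s => (h:ℂ)⁻¹ * (u (s + h) - u s) with hw
  have hwi : ∀ a b, IntervalIntegrable w volume a b := fun a b =>
    ((oim_shift u hii h a b).sub (hii a b)).const_mul _
  have hWc : Continuous fun t => ∫ s in (0:ℝ)..t, w s := intervalIntegral.continuous_primitive hwi 0
  have dec : ∫ t in (0:ℝ)..x, u t * Complex.cos (z * t) =
      (∫ t in (0:ℝ)..x, (u t - oimAvg u h t) * Complex.cos (z * t))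
      + oimAvg u h 0 * (∫ t in (0:ℝ)..x, Complex.cos (z * t))
      + ∫ s in (0:ℝ)..x, w s * ∫ t in s..x, Complex.cos (z * t) := by
    rw [← oim_triangle w _ x hx.1 (hwi _ _) hcc, ← intervalIntegral.integral_const_mul,
      ← intervalIntegral.integral_add, ← intervalIntegral.integral_add]
    · refine intervalIntegral.integral_congr fun t _ => ?_
      have := oimAvg_eq u hii h t
      simp only [hw]
      linear_combination (Complex.cos (z * t)) * this
    · exact (((hii _ _).sub (hvc.intervalIntegrable _ _)).mul_continuousOn hcc.continuousOn).add
        ((hcc.intervalIntegrable _ _).const_mul _)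
    · exact (hWc.mul hcc).intervalIntegrable _ _
    · exact ((hii _ _).sub (hvc.intervalIntegrable _ _)).mul_continuousOn hcc.continuousOn
    · exact (hcc.intervalIntegrable _ _).const_mul _
  have B1 : ‖∫ t in (0:ℝ)..x, (u t - oimAvg u h t) * Complex.cos (z * t)‖ ≤ ω * C := by
    have hd := fun a b => ((hii a b).sub (hvc.intervalIntegrable a b)).norm
    calc _ ≤ ∫ t in (0:ℝ)..x, ‖u t - oimAvg u h t‖ * C := by
          refine intervalIntegral.norm_integral_le_of_norm_le hx.1
            (Filter.Eventually.of_forall fun t ht => ?_) ((hd _ _).mul_const _)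
          rw [norm_mul]
          gcongr
          exact (oim_exp_bound α z hz2 t ⟨ht.1.le, ht.2.trans hx.2⟩).1
      _ = (∫ t in (0:ℝ)..x, ‖u t - oimAvg u h t‖) * C := intervalIntegral.integral_mul_const _ _
      _ ≤ _ := by
          gcongr
          exact (intervalIntegral.integral_mono_interval le_rfl hx.1 hx.2
            (Filter.Eventually.of_forall fun _ => norm_nonneg _) (hd _ _)).trans hL
  have B2 : ‖oimAvg u h 0 * (∫ t in (0:ℝ)..x, Complex.cos (z * t))‖ ≤ 2 * C * (2 * ω + h * I) := by
    rw [norm_mul]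
    calc _ ≤ ‖oimAvg u h 0‖ * (2 * C * h) := by
          gcongr
          exact hprim 0 ⟨le_rfl, hx.1⟩
      _ = 2 * C * (h * ‖oimAvg u h 0‖) := by ring
      _ ≤ _ := by
          gcongr
          exact oimAvg_bound u hper hii h hh hh1
  have B3 : ‖∫ s in (0:ℝ)..x, w s * ∫ t in s..x, Complex.cos (z * t)‖ ≤ 2 * C * ω := by
    calc _ ≤ ∫ s in (0:ℝ)..x, ‖w s‖ * (2 * C * h) := by
          refine intervalIntegral.norm_integral_le_of_norm_le hx.1
            (Filter.Eventually.of_forall fun t ht => ?_) ((hwi _ _).norm.mul_const _)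
          rw [norm_mul]
          gcongr
          exact hprim t ⟨ht.1.le, ht.2⟩
      _ = (∫ s in (0:ℝ)..x, ‖w s‖) * (2 * C * h) := intervalIntegral.integral_mul_const _ _
      _ ≤ (h⁻¹ * ω) * (2 * C * h) := by
          gcongr
          exact oim_w_bound u hper hii h hh x hx
      _ = _ := by field_simp
  rw [dec]
  refine (norm_add₃_le).trans ?_
  have p1 : 0 ≤ C * h := by positivity
  have p2 : 0 ≤ C * I * ω := by positivity
  nlinarith
end
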